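/- arXiv:1308.6763 — 5 statements merged into one kernel-verified Lean document; each statement's English description precedes it below -/
import Mathlib

section
/- Let φ : ℝ³ → ℝ be continuously differentiable. Fix points x_i, x_j ∈ ℝ³, set x_ij = x_i − x_j, and define the bond function b_ij : ℝ³ → ℝ by b_ij(x) = ∫₀¹ φ(x − x_i + λ x_ij) dλ. Then b_ij is differentiable and for every x ∈ ℝ³ one has the exact identity x_ij · ∇b_ij(x) = φ(x − x_j) − φ(x − x_i). -/
open Set Topology MeasureTheory

/-- Differentiation under the integral sign for the average of a `C¹` function along a segment. -/
theorem hasFDerivAt_intervalIntegral_add_smul {E F : Type*} [NormedAddCommGroup E]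
    [NormedSpace ℝ E] [ProperSpace E] [NormedAddCommGroup F] [NormedSpace ℝ F]
    {f : E → F} (hf : ContDiff ℝ 1 f) (a v x : E) :
    HasFDerivAt (fun y => ∫ l in (0 : ℝ)..1, f (y - a + l • v))
      (∫ l in (0 : ℝ)..1, fderiv ℝ f (x - a + l • v)) x := by
  have hf' : Continuous (fderiv ℝ f) := hf.continuous_fderiv one_ne_zero
  have hfc : Continuous f := hf.continuous
  obtain ⟨C, hC⟩ := ((isCompact_closedBall x 1).prod (isCompact_Icc (a := (0 : ℝ)) (b := 1))
    ).exists_bound_of_continuousOn (f := fun p : E × ℝ => fderiv ℝ f (p.1 - a + p.2 • v))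
      (by fun_prop)
  refine intervalIntegral.hasFDerivAt_integral_of_dominated_of_fderiv_le
    (F' := fun y l => fderiv ℝ f (y - a + l • v)) (bound := fun _ => C)
    (Metric.closedBall_mem_nhds x one_pos) ?_ ?_ ?_ ?_ intervalIntegrable_const ?_
  · exact .of_forall fun y => Continuous.aestronglyMeasurable (by fun_prop)
  · exact Continuous.intervalIntegrable (by fun_prop) _ _
  · exact Continuous.aestronglyMeasurable (by fun_prop)
  · refine .of_forall fun l hl y hy => hC (y, l) ⟨hy, ?_⟩
    rw [uIoc_of_le zero_le_one] at hl
    exact Ioc_subset_Icc_self hl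
  · refine .of_forall fun l _ y _ => ?_
    simpa [Function.comp_def] using
      ((hf.differentiable one_ne_zero) (y - a + l • v)).hasFDerivAt.comp y
        (((hasFDerivAt_id y).sub_const a).add_const (l • v))

/-- The derivative of a `C¹` function along a segment integrates to the difference of the
values at the endpoints. -/
theorem intervalIntegral_fderiv_add_smul_apply {E F : Type*} [NormedAddCommGroup E]
    [NormedSpace ℝ E] [NormedAddCommGroup F] [NormedSpace ℝ F] [CompleteSpace F]
    {f : E → F} (hf : ContDiff ℝ 1 f) (p v : E) :
    (∫ l in (0 : ℝ)..1, fderiv ℝ f (p + l • v)) v = f (p + v) - f p := by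
  have hf' : Continuous (fderiv ℝ f) := hf.continuous_fderiv one_ne_zero
  have hd (l : ℝ) : HasDerivAt (fun l : ℝ => f (p + l • v)) (fderiv ℝ f (p + l • v) v) l := by
    have hv : HasDerivAt (fun l : ℝ => p + l • v) v l := by
      simpa using ((hasDerivAt_id l).smul_const v).const_add p
    exact ((hf.differentiable one_ne_zero) (p + l • v)).hasFDerivAt.comp_hasDerivAt l hv
  rw [ContinuousLinearMap.intervalIntegral_apply
      (Continuous.intervalIntegrable (by fun_prop) _ _),
    intervalIntegral.integral_eq_sub_of_hasDerivAt (fun l _ => hd l)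
      (Continuous.intervalIntegrable (by fun_prop) _ _)]
  simp

/-- For a `C¹` kernel `φ : ℝ³ → ℝ` and points `xi, xj ∈ ℝ³`, the bond
function `b(x) = ∫₀¹ φ(x − xi + λ(xi − xj)) dλ` is differentiable and its directional
derivative along `x_ij = xi − xj` satisfies `x_ij · ∇b(x) = φ(x − xj) − φ(x − xi)`. -/
theorem bond_function_directional_derivative
    (φ : (Fin 3 → ℝ) → ℝ) (hφ : ContDiff ℝ 1 φ)
    (xi xj : Fin 3 → ℝ)
    (b : (Fin 3 → ℝ) → ℝ)
    (hb : ∀ x : Fin 3 → ℝ, b x = ∫ l in (0:ℝ)..1, φ (x - xi + l • (xi - xj))) :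
    Differentiable ℝ b ∧
      ∀ x : Fin 3 → ℝ, fderiv ℝ b x (xi - xj) = φ (x - xj) - φ (x - xi) := by
  obtain rfl : b = fun x => ∫ l in (0 : ℝ)..1, φ (x - xi + l • (xi - xj)) := funext hb
  have h := hasFDerivAt_intervalIntegral_add_smul hφ xi (xi - xj)
  refine ⟨fun x => (h x).differentiableAt, fun x => ?_⟩
  rw [(h x).fderiv, intervalIntegral_fderiv_add_smul_apply hφ, sub_add_sub_cancel]
end

section
/- Let I be a finite index set, let x_i ∈ ℝ³ (i ∈ I) be particle positions, and let f_ij ∈ ℝ³ (i ≠ j) be pairwise forces satisfying f_ij = −f_ji. Let φ : ℝ³ → ℝ be continuously differentiable, and define the Hardy stress σ̃ : ℝ³ → ℝ^{3×3} by σ̃(x) = −(1/2) Σ_{i∈I} Σ_{j≠i} f_ij (x_i − x_j)ᵀ b_ij(x), where b_ij(x) = ∫₀¹ φ(x − x_i + λ(x_i − x_j)) dλ. Then σ̃ is differentiable and its row-wise divergence satisfies, for all x ∈ ℝ³, (∇·σ̃)(x) = Σ_{i∈I} f_i φ(x − x_i), where f_i = Σ_{j≠i} f_ij is the total force on particle i.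 In particular, if the equilibrium equations −Σ_{j≠i} f_ij = b_i hold with body forces b_i ∈ ℝ³, then −(∇·σ̃)(x) = Σ_{i∈I} b_i φ(x − x_i). -/
/-- Differentiation under the integral sign for the average of a `C¹` function along a segment. -/
theorem hasFDerivAt_integral_segment {E : Type*} [NormedAddCommGroup E] [NormedSpace ℝ E]
    [ProperSpace E] {φ : E → ℝ} (hφ : ContDiff ℝ 1 φ) (a v y : E) :
    HasFDerivAt (fun y => ∫ l in (0 : ℝ)..1, φ (y - a + l • v))
      (∫ l in (0 : ℝ)..1, fderiv ℝ φ (y - a + l • v)) y := by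
  have hc := hφ.continuous
  have hd : Continuous (fderiv ℝ φ) := hφ.continuous_fderiv one_ne_zero
  obtain ⟨C, hC⟩ := ((isCompact_closedBall y 1).prod (isCompact_Icc (a := (0 : ℝ)) (b := 1)))
    |>.exists_bound_of_continuousOn (f := fun p : E × ℝ => fderiv ℝ φ (p.1 - a + p.2 • v))
      (by fun_prop)
  refine intervalIntegral.hasFDerivAt_integral_of_dominated_of_fderiv_le
    (F' := fun y l => fderiv ℝ φ (y - a + l • v)) (bound := fun _ => C)
    (Metric.closedBall_mem_nhds y one_pos) ?_ ?_ ?_ ?_ ?_ ?_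
  · exact .of_forall fun z => Continuous.aestronglyMeasurable (by fun_prop)
  · exact Continuous.intervalIntegrable (by fun_prop) _ _
  · exact Continuous.aestronglyMeasurable (by fun_prop)
  · refine .of_forall fun t ht z hz => hC (z, t) ⟨hz, ?_⟩
    rw [Set.uIoc_of_le zero_le_one] at ht
    exact Set.Ioc_subset_Icc_self ht
  · exact intervalIntegrable_const
  · refine .of_forall fun t _ z _ => ?_
    have h := (hφ.differentiable one_ne_zero (z - a + t • v)).hasFDerivAt
    exact h.comp z (((hasFDerivAt_id z).sub_const a).add_const (t • v))

theorem integral_fderiv_segment_apply {E : Type*} [NormedAddCommGroup E] [NormedSpace ℝ E]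
    {φ : E → ℝ} (hφ : ContDiff ℝ 1 φ) (a v : E) :
    (∫ l in (0 : ℝ)..1, fderiv ℝ φ (a + l • v)) v = φ (a + v) - φ a := by
  have hd : Continuous (fderiv ℝ φ) := hφ.continuous_fderiv one_ne_zero
  rw [ContinuousLinearMap.intervalIntegral_apply
    (Continuous.intervalIntegrable (by fun_prop) _ _)]
  rw [intervalIntegral.integral_eq_sub_of_hasDerivAt (f := fun l : ℝ => φ (a + l • v))]
  · simp
  · intro t _
    have h := (hφ.differentiable one_ne_zero (a + t • v)).hasFDerivAt
    have h2 : HasDerivAt (fun l : ℝ => a + l • v) v t := by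
      simpa using ((hasDerivAt_id t).smul_const v).const_add a
    exact h.comp_hasDerivAt t h2
  · exact Continuous.intervalIntegrable (by fun_prop) _ _

theorem ContinuousLinearMap.sum_apply_single_mul {n : Type*} [Fintype n] [DecidableEq n]
    (L : (n → ℝ) →L[ℝ] ℝ) (v : n → ℝ) : ∑ β, L (Pi.single β 1) * v β = L v := by
  conv_rhs => rw [pi_eq_sum_univ' v]
  simp [map_sum, mul_comm]

/-- Symmetrization of a double sum against an antisymmetric family. -/
theorem sum_sum_ne_mul_sub_of_antisymm {ι : Type*} [Fintype ι] [DecidableEq ι]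
    (F : ι → ι → ℝ) (hF : ∀ i j, i ≠ j → F i j = -F j i) (g : ι → ℝ) :
    -(1 / 2 : ℝ) * ∑ i, ∑ j ∈ Finset.univ.filter (fun j => j ≠ i), (g j - g i) * F i j
      = ∑ i, g i * ∑ j ∈ Finset.univ.filter (fun j => j ≠ i), F i j := by
  have hswap : ∑ i, ∑ j ∈ Finset.univ.filter (fun j => j ≠ i), g j * F i j
      = -∑ i, ∑ j ∈ Finset.univ.filter (fun j => j ≠ i), g i * F i j := by
    simp only [Finset.sum_filter]
    rw [Finset.sum_comm, ← Finset.sum_neg_distrib]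
    refine Finset.sum_congr rfl fun i _ => ?_
    rw [← Finset.sum_neg_distrib]
    refine Finset.sum_congr rfl fun j _ => ?_
    by_cases h : i = j
    · simp [h]
    · simp [h, Ne.symm h, hF j i (Ne.symm h)]
  simp only [sub_mul, Finset.sum_sub_distrib, hswap, Finset.mul_sum]
  ring


/-- For a finite particle system with antisymmetric pairwise forces and a
`C¹` kernel `φ`, the Hardy stress `σ̃(x) = −(1/2) Σ_i Σ_{j≠i} f_ij (x_i−x_j)ᵀ b_ij(x)` is
differentiable and its row-wise divergence equals `Σ_i f_i φ(x−x_i)`; in particular, under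
the equilibrium equations `−Σ_{j≠i} f_ij = b_i` one has `−(∇·σ̃)(x) = Σ_i b_i φ(x−x_i)`. -/
theorem hardy_stress_divergence
    {ι : Type*} [Fintype ι] [DecidableEq ι]
    (x : ι → (Fin 3 → ℝ)) (f : ι → ι → (Fin 3 → ℝ))
    (hanti : ∀ i j, i ≠ j → f i j = - f j i)
    (φ : (Fin 3 → ℝ) → ℝ) (hφ : ContDiff ℝ 1 φ)
    (b : ι → ι → (Fin 3 → ℝ) → ℝ)
    (hb : ∀ i j (x' : Fin 3 → ℝ),
      b i j x' = ∫ l in (0:ℝ)..1, φ (x' - x i + l • (x i - x j)))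
    (σ : (Fin 3 → ℝ) → Matrix (Fin 3) (Fin 3) ℝ)
    (hσ : ∀ x' : Fin 3 → ℝ, σ x' = -(1/2 : ℝ) •
      ∑ i, ∑ j ∈ Finset.univ.filter (fun j => j ≠ i),
        b i j x' • Matrix.vecMulVec (f i j) (x i - x j)) :
    (∀ α β : Fin 3, Differentiable ℝ fun x' => σ x' α β) ∧
    (∀ (x' : Fin 3 → ℝ) (α : Fin 3),
      (∑ β, fderiv ℝ (fun y => σ y α β) x' (Pi.single β 1))
        = ∑ i, φ (x' - x i) *
            (∑ j ∈ Finset.univ.filter (fun j => j ≠ i), f i j) α) ∧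
    (∀ bf : ι → (Fin 3 → ℝ),
      (∀ i, (- ∑ j ∈ Finset.univ.filter (fun j => j ≠ i), f i j) = bf i) →
      ∀ (x' : Fin 3 → ℝ) (α : Fin 3),
        (- ∑ β, fderiv ℝ (fun y => σ y α β) x' (Pi.single β 1))
          = ∑ i, bf i α * φ (x' - x i)) := by
  set L : ι → ι → (Fin 3 → ℝ) → (Fin 3 → ℝ) →L[ℝ] ℝ := fun i j y =>
    ∫ l in (0 : ℝ)..1, fderiv ℝ φ (y - x i + l • (x i - x j)) with hL
  have hbd : ∀ i j y, HasFDerivAt (b i j) (L i j y) y := by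
    intro i j y
    rw [funext (hb i j)]
    exact hasFDerivAt_integral_segment hφ (x i) (x i - x j) y
  have hLv : ∀ i j y, L i j y (x i - x j) = φ (y - x j) - φ (y - x i) := by
    intro i j y
    simpa using integral_fderiv_segment_apply hφ (y - x i) (x i - x j)
  have hσd : ∀ α β y, HasFDerivAt (fun y => σ y α β)
      (-(1 / 2 : ℝ) • ∑ i, ∑ j ∈ Finset.univ.filter (fun j => j ≠ i),
        (f i j α * (x i - x j) β) • L i j y) y := by
    intro α β y
    have hσe : (fun y => σ y α β) = fun y => -(1 / 2 : ℝ) •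
        ∑ i, ∑ j ∈ Finset.univ.filter (fun j => j ≠ i),
          b i j y * (f i j α * (x i - x j) β) := by
      funext y
      simp [hσ, Matrix.sum_apply, Matrix.vecMulVec_apply]
    rw [hσe]
    refine HasFDerivAt.fun_const_smul ?_ (-(1 / 2 : ℝ))
    exact HasFDerivAt.fun_sum fun i _ => HasFDerivAt.fun_sum fun j _ =>
      (hbd i j y).mul_const _
  have hdiv : ∀ (y : Fin 3 → ℝ) (α : Fin 3),
      (∑ β, fderiv ℝ (fun y => σ y α β) y (Pi.single β 1))
        = ∑ i, φ (y - x i) * (∑ j ∈ Finset.univ.filter (fun j => j ≠ i), f i j) α := by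
    intro y α
    simp only [Finset.sum_apply]
    rw [← sum_sum_ne_mul_sub_of_antisymm (fun i j => f i j α)
      (fun i j h => by simp [hanti i j h]) fun i => φ (y - x i)]
    simp only [(hσd α _ y).fderiv, smul_apply, sum_apply, smul_eq_mul]
    rw [← Finset.mul_sum, Finset.sum_comm]
    congr 1
    refine Finset.sum_congr rfl fun i _ => ?_
    rw [Finset.sum_comm]
    refine Finset.sum_congr rfl fun j _ => ?_
    rw [← hLv, ← ContinuousLinearMap.sum_apply_single_mul, Finset.sum_mul]
    exact Finset.sum_congr rfl fun β _ => by ring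
  refine ⟨fun α β y => (hσd α β y).differentiableAt, hdiv, fun bf hbf y α => ?_⟩
  rw [hdiv, ← Finset.sum_neg_distrib]
  refine Finset.sum_congr rfl fun i _ => ?_
  rw [← hbf i, Pi.neg_apply]
  ring
end

section
/- Let L = {B n : n ∈ ℤ³} be a Bravais lattice in ℝ³ with B an invertible real 3×3 matrix and unit-cell volume Ω₀ = |det B|, and let φ₀ : ℝ³ → ℝ be a kernel (compactly supported, φ₀(−x) = φ₀(x)) satisfying the first moment condition Σ_{y∈L} φ₀(y) = 1/Ω₀ and the second moment condition Σ_{y∈L} φ₀(y) y yᵀ = 0 ∈ ℝ^{3×3}. For ε > 0 and w : ℝ³ → ℝ define the sampled function w̃_ε(x) = Ω₀ Σ_{y∈L} φ₀(y) w(x + εy). Then there exists a constant C, depending only on φ₀ and B, such that for every four times continuously differentiable w : ℝ³ → ℝ whose fourth-order partial derivatives are all bounded in absolute value by M, every ε ∈ (0,1], and every x ∈ ℝ³, one has |w̃_ε(x) − w(x)| ≤ C M ε⁴. -/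
open scoped BigOperators

/-- The Bravais lattice generated by an (invertible) matrix `B`. -/
def bravaisLattice (B : Matrix (Fin 3) (Fin 3) ℝ) : Set (Fin 3 → ℝ) :=
  {x | ∃ n : Fin 3 → ℤ, x = B.mulVec (fun k => (n k : ℝ))}

/-- A multilinear form that is bounded by `M` on tuples of standard basis vectors is bounded by
`M * ‖y‖₁ ^ n` on the diagonal. -/
lemma abs_multilinear_diagonal_le {ι : Type*} [Fintype ι] [DecidableEq ι] {n : ℕ} {M : ℝ}
    (f : ContinuousMultilinearMap ℝ (fun _ : Fin n => ι → ℝ) ℝ)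
    (hf : ∀ idx : Fin n → ι, |f (fun k => Pi.single (idx k) 1)| ≤ M) (y : ι → ℝ) :
    |f (fun _ => y)| ≤ M * (∑ i, |y i|) ^ n := by
  have hy : (fun _ : Fin n => y) = fun _ => ∑ i, y i • (Pi.single i 1 : ι → ℝ) := by
    funext _
    exact pi_eq_sum_univ' y
  rw [hy, f.map_sum, Fintype.sum_pow, Finset.mul_sum]
  refine (Finset.abs_sum_le_sum_abs _ _).trans (Finset.sum_le_sum fun idx _ => ?_)
  rw [f.map_smul_univ (fun k => y (idx k)), smul_eq_mul, abs_mul, Finset.abs_prod, mul_comm]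
  exact mul_le_mul_of_nonneg_right (hf idx) (Finset.prod_nonneg fun _ _ => abs_nonneg _)

/-- Third-order Taylor expansion with the remainder controlled by the fourth-order partial
derivatives. -/
lemma abs_sub_taylor_three_le {ι : Type*} [Fintype ι] [DecidableEq ι] {w : (ι → ℝ) → ℝ} {M : ℝ}
    (hw : ContDiff ℝ 4 w)
    (hM : ∀ (x : ι → ℝ) (idx : Fin 4 → ι),
      |iteratedFDeriv ℝ 4 w x (fun k => Pi.single (idx k) 1)| ≤ M) (x y : ι → ℝ) :
    |w (x + y) - ∑ k ∈ Finset.range 4,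
      (k.factorial : ℝ)⁻¹ * iteratedFDeriv ℝ k w x (fun _ => y)| ≤ M * (∑ i, |y i|) ^ 4 := by
  have htaylor := map_add_eq_sum_add_integral_iteratedFDeriv (n := 3) (f := w) (x := x) (y := y)
    (fun t _ => by norm_num; exact hw.contDiffAt)
  norm_num only at htaylor
  simp only [smul_eq_mul] at htaylor
  rw [htaylor, add_sub_cancel_left]
  have hint : ‖∫ t in (0 : ℝ)..1, (1 - t) ^ 3 * iteratedFDeriv ℝ 4 w (x + t • y) (fun _ => y)‖ ≤
      M * (∑ i, |y i|) ^ 4 * |(1 : ℝ) - 0| := by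
    refine intervalIntegral.norm_integral_le_of_norm_le_const fun t ht => ?_
    rw [Set.uIoc_of_le zero_le_one] at ht
    rw [Real.norm_eq_abs, abs_mul]
    have h1 : |(1 - t) ^ 3| ≤ 1 := by
      rw [abs_of_nonneg (pow_nonneg (by linarith [ht.2]) 3)]
      exact pow_le_one₀ (by linarith [ht.2]) (by linarith [ht.1])
    have h2 := abs_multilinear_diagonal_le _ (hM (x + t • y)) y
    nlinarith [abs_nonneg (iteratedFDeriv ℝ 4 w (x + t • y) (fun _ => y)), abs_nonneg ((1 - t) ^ 3)]
  rw [Real.norm_eq_abs, sub_zero, abs_one, mul_one] at hint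
  rw [abs_mul]
  have h6 : |(1 / 6 : ℝ)| ≤ 1 := by norm_num [abs_of_pos]
  exact (mul_le_of_le_one_left (abs_nonneg _) h6).trans hint

lemma neg_mem_bravaisLattice {B : Matrix (Fin 3) (Fin 3) ℝ} {y : Fin 3 → ℝ}
    (hy : y ∈ bravaisLattice B) : -y ∈ bravaisLattice B := by
  obtain ⟨n, rfl⟩ := hy
  refine ⟨-n, ?_⟩
  rw [← Matrix.mulVec_neg]
  congr 1
  ext k
  simp

lemma finite_bravaisLattice_inter {B : Matrix (Fin 3) (Fin 3) ℝ} (hB : IsUnit B.det)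
    {K : Set (Fin 3 → ℝ)} (hK : IsCompact K) : (bravaisLattice B ∩ K).Finite := by
  have hcast : Topology.IsClosedEmbedding (fun (n : Fin 3 → ℤ) (k : Fin 3) => (n k : ℝ)) :=
    .piMap fun _ => Int.isClosedEmbedding_coe_real
  have hK' : IsCompact (B⁻¹.mulVec '' K) :=
    hK.image (Continuous.matrix_mulVec continuous_const continuous_id)
  refine ((isCompact_iff_finite.mp (hcast.isCompact_preimage hK')).image
    fun n => B.mulVec (fun k => (n k : ℝ))).subset ?_
  rintro _ ⟨⟨n, rfl⟩, hn⟩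
  exact ⟨n, ⟨_, hn, by simp [Matrix.mulVec_mulVec, Matrix.nonsing_inv_mul B hB]⟩, rfl⟩

lemma sum_eq_zero_of_odd {E : Type*} [InvolutiveNeg E] {S : Finset E}
    (hS : ∀ y ∈ S, -y ∈ S) {f : E → ℝ} (hf : ∀ y, f (-y) = -f y) : ∑ y ∈ S, f y = 0 := by
  have h : ∑ y ∈ S, f y = ∑ y ∈ S, f (-y) :=
    Finset.sum_bij' (fun y _ => -y) (fun y _ => -y) hS hS (by simp) (by simp) (by simp)
  simp only [hf, Finset.sum_neg_distrib] at h
  linarith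

/-- Let `L` be a Bravais lattice with unit-cell volume `Ω₀ = |det B|` and
`φ₀` a compactly supported even kernel satisfying the first moment condition
`Σ_{y∈L} φ₀(y) = 1/Ω₀` and the second moment condition `Σ_{y∈L} φ₀(y) y yᵀ = 0`. Then
there is a constant `C` (depending only on `φ₀` and `B`) such that for every `C⁴`
function `w` with fourth partial derivatives bounded by `M`, every `ε ∈ (0,1]`, and every
`x`, the sampled function `w̃_ε(x) = Ω₀ Σ_{y∈L} φ₀(y) w(x + εy)` satisfies
`|w̃_ε(x) − w(x)| ≤ C M ε⁴`. -/
theorem sampled_function_fourth_order_accuracy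
    (B : Matrix (Fin 3) (Fin 3) ℝ) (hB : IsUnit B.det)
    (φ₀ : (Fin 3 → ℝ) → ℝ) (hc : HasCompactSupport φ₀)
    (hsymm : ∀ x : Fin 3 → ℝ, φ₀ (-x) = φ₀ x)
    (hm0 : (∑ᶠ y ∈ bravaisLattice B, φ₀ y) = 1 / |B.det|)
    (hm2 : ∀ α β : Fin 3, (∑ᶠ y ∈ bravaisLattice B, φ₀ y * y α * y β) = 0) :
    ∃ C : ℝ, ∀ (w : (Fin 3 → ℝ) → ℝ) (M : ℝ), ContDiff ℝ 4 w →
      (∀ (x : Fin 3 → ℝ) (idx : Fin 4 → Fin 3),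
        |iteratedFDeriv ℝ 4 w x (fun k => Pi.single (idx k) 1)| ≤ M) →
      ∀ ε : ℝ, ε ∈ Set.Ioc (0:ℝ) 1 → ∀ x : Fin 3 → ℝ,
        |(|B.det| : ℝ) * (∑ᶠ y ∈ bravaisLattice B, φ₀ y * w (x + ε • y)) - w x|
          ≤ C * M * ε ^ 4 := by
  set S : Finset (Fin 3 → ℝ) := (finite_bravaisLattice_inter hB hc.isCompact).toFinset with hSdef
  have hsum (f : (Fin 3 → ℝ) → ℝ) (hf : ∀ y, φ₀ y = 0 → f y = 0) :
      (∑ᶠ y ∈ bravaisLattice B, f y) = ∑ y ∈ S, f y := by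
    refine finsum_mem_eq_sum_of_subset f ?_ ?_
    · rintro y ⟨hyL, hy⟩
      simpa [S] using ⟨hyL, subset_tsupport φ₀ fun h => hy (hf y h)⟩
    · simp [S]
  have hneg : ∀ y ∈ S, -y ∈ S := by
    intro y hy
    rw [hSdef, Set.Finite.mem_toFinset] at hy ⊢
    refine ⟨neg_mem_bravaisLattice hy.1, ?_⟩
    have h := tsupport_comp_eq_preimage φ₀ (Homeomorph.neg (Fin 3 → ℝ))
    have he : φ₀ ∘ Homeomorph.neg (Fin 3 → ℝ) = φ₀ := funext hsymm
    rw [he] at h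
    exact h.subset hy.2
  rw [hsum _ fun y h => h] at hm0
  have hm2' (α β : Fin 3) : ∑ y ∈ S, φ₀ y * (y α * y β) = 0 := by
    rw [← hm2 α β, hsum _ fun y h => by simp [h]]
    exact Finset.sum_congr rfl fun y _ => (mul_assoc _ _ _).symm
  have hdet : |B.det| ≠ 0 := abs_ne_zero.mpr hB.ne_zero
  refine ⟨|B.det| * ∑ y ∈ S, |φ₀ y| * (∑ i, |y i|) ^ 4, fun w M hw hM ε hε x => ?_⟩
  rw [hsum _ fun y h => by simp [h]]
  have hodd (k : ℕ) (hk : Odd k) :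
      ∑ y ∈ S, φ₀ y * iteratedFDeriv ℝ k w x (fun _ => ε • y) = 0 := by
    refine sum_eq_zero_of_odd hneg fun y => ?_
    have h := (iteratedFDeriv ℝ k w x).map_smul_univ (fun _ => (-1 : ℝ)) (fun _ => ε • y)
    simp only [neg_smul, one_smul, Finset.prod_const, Finset.card_univ, Fintype.card_fin,
      hk.neg_one_pow, smul_eq_mul] at h
    rw [hsymm, smul_neg, h]
    ring
  have htwo : ∑ y ∈ S, φ₀ y * iteratedFDeriv ℝ 2 w x (fun _ => ε • y) = 0 := by
    have hexp (y : Fin 3 → ℝ) : iteratedFDeriv ℝ 2 w x (fun _ => ε • y) =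
        ∑ idx : Fin 2 → Fin 3, ε ^ 2 * (y (idx 0) * y (idx 1)) *
          iteratedFDeriv ℝ 2 w x (fun k => Pi.single (idx k) 1) := by
      have hy : (fun _ : Fin 2 => ε • y) =
          fun _ => ∑ i, (ε * y i) • (Pi.single i 1 : Fin 3 → ℝ) := by
        funext _
        exact pi_eq_sum_univ' (ε • y)
      rw [hy, ContinuousMultilinearMap.map_sum]
      refine Finset.sum_congr rfl fun idx _ => ?_
      rw [ContinuousMultilinearMap.map_smul_univ _ (fun k => ε * y (idx k)), Fin.prod_univ_two,
        smul_eq_mul]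
      ring
    simp only [hexp, Finset.mul_sum]
    rw [Finset.sum_comm]
    refine Finset.sum_eq_zero fun idx _ => ?_
    rw [← mul_zero (ε ^ 2 * iteratedFDeriv ℝ 2 w x (fun k => Pi.single (idx k) 1)),
      ← hm2' (idx 0) (idx 1), Finset.mul_sum]
    exact Finset.sum_congr rfl fun y _ => by ring
  have hpoly : ∑ y ∈ S, φ₀ y * ∑ k ∈ Finset.range 4,
      (k.factorial : ℝ)⁻¹ * iteratedFDeriv ℝ k w x (fun _ => ε • y) = w x / |B.det| := by
    have hswap (k : ℕ) : ∑ y ∈ S, φ₀ y * ((k.factorial : ℝ)⁻¹ *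
        iteratedFDeriv ℝ k w x (fun _ => ε • y)) = (k.factorial : ℝ)⁻¹ *
        ∑ y ∈ S, φ₀ y * iteratedFDeriv ℝ k w x (fun _ => ε • y) := by
      rw [Finset.mul_sum]
      exact Finset.sum_congr rfl fun y _ => by ring
    simp only [Finset.mul_sum (Finset.range 4)]
    rw [Finset.sum_comm]
    simp only [hswap, Finset.sum_range_succ, Finset.sum_range_zero, htwo, hodd 1 odd_one,
      hodd 3 (by decide), iteratedFDeriv_zero_apply, ← Finset.sum_mul, hm0]
    simp [div_eq_inv_mul]
  have hrem : |B.det| * (∑ y ∈ S, φ₀ y * w (x + ε • y)) - w x = |B.det| * ∑ y ∈ S, φ₀ y *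
      (w (x + ε • y) - ∑ k ∈ Finset.range 4,
        (k.factorial : ℝ)⁻¹ * iteratedFDeriv ℝ k w x (fun _ => ε • y)) := by
    simp only [mul_sub, Finset.sum_sub_distrib]
    rw [hpoly, mul_div_cancel₀ _ hdet]
  rw [hrem, abs_mul, abs_abs, mul_assoc, mul_assoc]
  refine mul_le_mul_of_nonneg_left ?_ (abs_nonneg _)
  rw [Finset.sum_mul]
  refine (Finset.abs_sum_le_sum_abs _ _).trans (Finset.sum_le_sum fun y _ => ?_)
  rw [abs_mul, mul_assoc]
  refine mul_le_mul_of_nonneg_left ?_ (abs_nonneg _)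
  refine (abs_sub_taylor_three_le hw hM x (ε • y)).trans_eq ?_
  simp only [Pi.smul_apply, smul_eq_mul, abs_mul, abs_of_pos hε.1, ← Finset.mul_sum]
  ring
end

section
/- Let L = {B n : n ∈ ℤ³} be a Bravais lattice in ℝ³ with B an invertible real 3×3 matrix, and let φ₀ : ℝ³ → ℝ be a smooth (C^∞) kernel, i.e. compactly supported with φ₀(−x) = φ₀(x) for all x. For R ≥ 1 define the scaled kernel φ_R(x) = R^{−3} φ₀(x/R), and the lattice moments m₀(R) = Σ_{y∈L} φ_R(y) and μ₁(R) = −Σ_{y∈L} ∇φ_R(y) yᵀ ∈ ℝ^{3×3}. Then there exists a constant C, depending only on φ₀ and B, such that for all R ≥ 1: ‖μ₁(R) − m₀(R) I₃‖ ≤ C R^{−3}. -/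
open scoped BigOperators

/-- If every member of a chain of successive derivatives takes the same value at `0` and `ε`,
then each differentiation order gains a factor `ε` in the bound for the first derivative. -/
lemma abs_le_mul_pow_of_hasDerivAt_of_eq {ε : ℝ} (hε : 0 < ε) {h : ℕ → ℝ → ℝ}
    (hd : ∀ k t, HasDerivAt (h k) (h (k + 1) t) t) (hper : ∀ k, h k 0 = h k ε) (m : ℕ) {M : ℝ}
    (hM : ∀ t ∈ Set.Icc 0 ε, |h (m + 1) t| ≤ M) {t : ℝ} (ht : t ∈ Set.Icc 0 ε) :
    |h 1 t| ≤ M * ε ^ m := by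
  induction m generalizing M with
  | zero => simpa using hM t ht
  | succ m ih =>
    have hstep : ∀ s ∈ Set.Icc 0 ε, |h (m + 1) s| ≤ M * ε := by
      intro s hs
      obtain ⟨c, hc, hc0⟩ := exists_hasDerivAt_eq_zero hε
        (fun x _ => (hd m x).continuousAt.continuousWithinAt) (hper m) (fun x _ => hd m x)
      have hM0 : 0 ≤ M := (abs_nonneg _).trans (hM s hs)
      have hle := (convex_Icc (0 : ℝ) ε).norm_image_sub_le_of_norm_hasDerivWithin_le
        (fun x _ => (hd (m + 1) x).hasDerivWithinAt) hM (Set.Ioo_subset_Icc_self hc) hs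
      rw [hc0, sub_zero, Real.norm_eq_abs, Real.norm_eq_abs] at hle
      refine hle.trans (mul_le_mul_of_nonneg_left ?_ hM0)
      rw [abs_le]
      constructor <;> linarith [hs.1, hs.2, hc.1, hc.2]
    calc |h 1 t| ≤ M * ε * ε ^ m := ih hstep
      _ = M * ε ^ (m + 1) := by ring

section LatticeSums

variable {ι : Type*} [Fintype ι]

lemma finite_support_comp_inv_smul_intCast {F : (ι → ℝ) → ℝ} (hF : HasCompactSupport F)
    {R : ℝ} (hR : 0 < R) :
    (Function.support fun n : ι → ℤ => F (R⁻¹ • fun k => (n k : ℝ))).Finite := by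
  classical
  obtain ⟨K, hsub⟩ := hF.isCompact.isBounded.subset_closedBall 0
  have hK : ∀ x, F x ≠ 0 → ‖x‖ ≤ K := fun x hx =>
    mem_closedBall_zero_iff.1 (hsub (subset_tsupport F hx))
  refine (Set.finite_Icc (fun _ : ι => -⌈K * R⌉) (fun _ => ⌈K * R⌉)).subset fun n hn => ?_
  have key : ∀ k, |(n k : ℝ)| ≤ ⌈K * R⌉ := fun k => by
    have h1 := (norm_le_pi_norm _ k).trans (hK _ hn)
    rw [Pi.smul_apply, smul_eq_mul, norm_mul, norm_inv, Real.norm_of_nonneg hR.le,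
      inv_mul_le_iff₀ hR, Real.norm_eq_abs, mul_comm] at h1
    exact h1.trans (Int.le_ceil _)
  exact ⟨fun k => by exact_mod_cast (abs_le.1 (key k)).1,
    fun k => by exact_mod_cast (abs_le.1 (key k)).2⟩

/-- Rescaled lattice sums of a coordinate derivative of a test function stay bounded. -/
lemma exists_abs_finsum_fderiv_single_le [DecidableEq ι] {F : (ι → ℝ) → ℝ}
    (hF : ContDiff ℝ (⊤ : ℕ∞) F) (hc : HasCompactSupport F) (i : ι) :
    ∃ C : ℝ, ∀ R : ℝ, 1 ≤ R →
      |∑ᶠ n : ι → ℤ, fderiv ℝ F (R⁻¹ • fun k => (n k : ℝ)) (Pi.single i 1)| ≤ C := by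
  set e : ι → ℝ := Pi.single i 1 with he
  let D : ((ι → ℝ) → ℝ) → (ι → ℝ) → ℝ := fun G x => fderiv ℝ G x e
  have hsm : ∀ k, ContDiff ℝ (⊤ : ℕ∞) (D^[k] F) := by
    intro k
    induction k with
    | zero => exact hF
    | succ k ih =>
      rw [Function.iterate_succ_apply']
      exact (ih.fderiv_right (m := (⊤ : ℕ∞)) (by simp)).clm_apply contDiff_const
  have hzero : ∀ k x, x ∉ tsupport F → D^[k] F x = 0 := by
    have : ∀ k, tsupport (D^[k] F) ⊆ tsupport F := by
      intro k
      induction k with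
      | zero => exact subset_rfl
      | succ k ih =>
        rw [Function.iterate_succ_apply']
        exact (tsupport_fderiv_apply_subset ℝ e).trans ih
    exact fun k x hx => image_eq_zero_of_notMem_tsupport fun h => hx (this k h)
  have hcs : ∀ k, HasCompactSupport (D^[k] F) := fun k =>
    HasCompactSupport.intro hc.isCompact fun x hx => hzero k x hx
  obtain ⟨r, hr⟩ := hc.isCompact.isBounded.subset_closedBall 0
  obtain ⟨K, hK0, hrK⟩ : ∃ K : ℝ, 0 ≤ K ∧ r ≤ K := ⟨max r 0, le_max_right _ _, le_max_left _ _⟩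
  have hK : ∀ k x, D^[k] F x ≠ 0 → ‖x‖ ≤ K := fun k x hx => by
    by_contra hlt
    refine hx (hzero k x fun h => hlt ?_)
    exact (mem_closedBall_zero_iff.1 (hr h)).trans hrK
  obtain ⟨M, hM⟩ := (hcs (Fintype.card ι + 1)).exists_bound_of_continuous (hsm _).continuous
  have hM0 : 0 ≤ M := (norm_nonneg _).trans (hM 0)
  refine ⟨(2 * K + 5) ^ Fintype.card ι * M, fun R hR => ?_⟩
  have hR0 : 0 < R := one_pos.trans_le hR
  set N : ℕ := ⌈(K + 1) * R⌉₊ with hN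
  have hN1 : (K + 1) * R ≤ N := Nat.le_ceil _
  have hN2 : (N : ℝ) < (K + 1) * R + 1 := Nat.ceil_lt_add_one (by positivity)
  let S : Finset (ι → ℤ) := Fintype.piFinset fun _ => Finset.Icc (-(N : ℤ)) N
  have hS : ∀ n : ι → ℤ, (∀ k, |(n k : ℝ)| ≤ N) → n ∈ S := by
    intro n hn
    refine Fintype.mem_piFinset.2 fun k => Finset.mem_Icc.2 ?_
    have := abs_le.1 (hn k)
    exact ⟨by exact_mod_cast this.1, by exact_mod_cast this.2⟩
  let h : ℕ → ℝ → ℝ := fun k t => ∑ n ∈ S, (D^[k] F) ((R⁻¹ • fun j => (n j : ℝ)) + t • e)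
  have hcoord : ∀ k (n : ι → ℤ), (D^[k] F) (R⁻¹ • fun j => (n j : ℝ)) ≠ 0 →
      ∀ j, |(n j : ℝ)| ≤ K * R := fun k n hn j => by
    have h1 := (norm_le_pi_norm _ j).trans (hK k _ hn)
    rwa [Pi.smul_apply, smul_eq_mul, norm_mul, norm_inv, Real.norm_of_nonneg hR0.le,
      inv_mul_le_iff₀ hR0, Real.norm_eq_abs, mul_comm] at h1
  have hh0 : ∀ k, h k 0 = ∑ᶠ n : ι → ℤ, (D^[k] F) (R⁻¹ • fun j => (n j : ℝ)) := by
    intro k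
    rw [finsum_eq_sum_of_support_subset (s := S)]
    · simp [h]
    · intro n hn
      exact hS n fun j => (hcoord k n hn j).trans (by nlinarith)
  let σ : (ι → ℤ) ≃ (ι → ℤ) := Equiv.addRight (Pi.single i 1)
  have hσ : ∀ n : ι → ℤ, (R⁻¹ • fun j => (n j : ℝ)) + R⁻¹ • e =
      R⁻¹ • fun j => ((σ n j : ℤ) : ℝ) := by
    intro n
    ext j
    by_cases hj : j = i
    · subst hj
      simp [σ, he, mul_add]
    · simp [σ, he, hj]
  have hhε : ∀ k, h k 0 = h k R⁻¹ := by
    intro k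
    rw [hh0, ← finsum_comp_equiv σ, finsum_eq_sum_of_support_subset (s := S)]
    · exact Finset.sum_congr rfl fun n _ => by rw [hσ]
    · intro n hn
      refine hS n fun j => ?_
      have h1 := hcoord k _ hn j
      have h2 : |((Pi.single i 1 : ι → ℤ) j : ℝ)| ≤ 1 := by
        by_cases hj : j = i
        · subst hj; simp
        · simp [hj]
      have h3 : (n j : ℝ) = (σ n j : ℝ) - ((Pi.single i 1 : ι → ℤ) j : ℝ) := by simp [σ]
      rw [h3]
      refine (abs_sub _ _).trans ?_
      nlinarith
  have hderiv : ∀ k t, HasDerivAt (h k) (h (k + 1) t) t := by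
    intro k t
    refine HasDerivAt.fun_sum fun n _ => ?_
    have h1 : HasDerivAt (fun t : ℝ => (R⁻¹ • fun j => (n j : ℝ)) + t • e) e t := by
      simpa using ((hasDerivAt_id t).smul_const e).const_add (R⁻¹ • fun j => (n j : ℝ))
    have h2 := ((hsm k).differentiable (by simp)
      ((R⁻¹ • fun j => (n j : ℝ)) + t • e)).hasFDerivAt.comp_hasDerivAt t h1
    rw [Function.iterate_succ_apply']
    exact h2
  have hcard : (S.card : ℝ) ≤ ((2 * K + 5) * R) ^ Fintype.card ι := by
    have : S.card = (2 * N + 1) ^ Fintype.card ι := by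
      simp only [S, Fintype.card_piFinset, Int.card_Icc, Finset.prod_const, Finset.card_univ]
      congr 1
      omega
    rw [this]
    push_cast
    gcongr
    nlinarith
  have hbound : ∀ t ∈ Set.Icc 0 R⁻¹,
      |h (Fintype.card ι + 1) t| ≤ ((2 * K + 5) * R) ^ Fintype.card ι * M := by
    intro t _
    calc |h (Fintype.card ι + 1) t| ≤ ∑ n ∈ S, M :=
          (Finset.abs_sum_le_sum_abs _ _).trans (Finset.sum_le_sum fun n _ => hM _)
      _ = S.card * M := by simp
      _ ≤ _ := by gcongr
  have key := abs_le_mul_pow_of_hasDerivAt_of_eq (inv_pos.2 hR0) hderiv hhε _ hbound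
    (t := 0) ⟨le_rfl, (inv_pos.2 hR0).le⟩
  rw [hh0] at key
  refine key.trans (le_of_eq ?_)
  rw [mul_pow, inv_pow]
  field_simp

/-- Rescaled lattice sums of a directional derivative of a test function stay bounded. -/
lemma exists_abs_finsum_fderiv_le {F : (ι → ℝ) → ℝ}
    (hF : ContDiff ℝ (⊤ : ℕ∞) F) (hc : HasCompactSupport F) (v : ι → ℝ) :
    ∃ C : ℝ, ∀ R : ℝ, 1 ≤ R →
      |∑ᶠ n : ι → ℤ, fderiv ℝ F (R⁻¹ • fun k => (n k : ℝ)) v| ≤ C := by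
  classical
  choose C hC using exists_abs_finsum_fderiv_single_le hF hc
  refine ⟨∑ i, |v i| * C i, fun R hR => ?_⟩
  have hR0 : 0 < R := one_pos.trans_le hR
  have hexp : ∀ x, fderiv ℝ F x v = ∑ i, v i * fderiv ℝ F x (Pi.single i 1) := fun x => by
    conv_lhs => rw [pi_eq_sum_univ' v]
    simp [map_sum]
  have hfin : ∀ i, (Function.support fun n : ι → ℤ =>
      fderiv ℝ F (R⁻¹ • fun k => (n k : ℝ)) (Pi.single i 1)).Finite := fun i =>
    finite_support_comp_inv_smul_intCast (hc.fderiv_apply ℝ (Pi.single i 1)) hR0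
  simp_rw [hexp]
  rw [finsum_sum_comm _ _ fun i _ =>
    (hfin i).subset fun n hn => right_ne_zero_of_mul hn]
  refine (Finset.abs_sum_le_sum_abs _ _).trans (Finset.sum_le_sum fun i _ => ?_)
  rw [← mul_finsum, abs_mul]
  exact mul_le_mul_of_nonneg_left (hC i R hR) (abs_nonneg _)

end LatticeSums

lemma finsum_mem_bravaisLattice {B : Matrix (Fin 3) (Fin 3) ℝ} (hB : IsUnit B.det)
    (f : (Fin 3 → ℝ) → ℝ) :
    ∑ᶠ y ∈ bravaisLattice B, f y = ∑ᶠ n : Fin 3 → ℤ, f (B.mulVec fun k => (n k : ℝ)) := by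
  have hrange : bravaisLattice B =
      Set.range fun n : Fin 3 → ℤ => B.mulVec fun k => (n k : ℝ) := by
    ext x
    simp [bravaisLattice, eq_comm]
  rw [hrange, finsum_mem_range]
  intro m n hmn
  have := Matrix.mulVec_injective_of_isUnit ((Matrix.isUnit_iff_isUnit_det B).2 hB) hmn
  ext k
  exact_mod_cast congrFun this k

/-- Let `L` be a Bravais lattice and `φ₀` a smooth compactly supported
even kernel. For `R ≥ 1` let `φ_R(x) = R⁻³ φ₀(x/R)`, `m₀(R) = Σ_{y∈L} φ_R(y)` and
`μ₁(R) = −Σ_{y∈L} ∇φ_R(y) yᵀ`. Then there is a constant `C` (depending only on `φ₀` and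
`B`) such that `‖μ₁(R) − m₀(R) I₃‖ ≤ C R⁻³` (entrywise) for all `R ≥ 1`. -/
theorem gradient_moment_close_to_zeroth_moment
    (B : Matrix (Fin 3) (Fin 3) ℝ) (hB : IsUnit B.det)
    (φ₀ : (Fin 3 → ℝ) → ℝ) (hφ : ContDiff ℝ (⊤ : ℕ∞) φ₀) (hc : HasCompactSupport φ₀)
    (hsymm : ∀ x : Fin 3 → ℝ, φ₀ (-x) = φ₀ x) :
    ∃ C : ℝ, ∀ R : ℝ, 1 ≤ R → ∀ α β : Fin 3,
      |(- ∑ᶠ y ∈ bravaisLattice B,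
            fderiv ℝ (fun z => (R ^ 3)⁻¹ * φ₀ (R⁻¹ • z)) y (Pi.single α 1) * y β)
        - (if α = β then (∑ᶠ y ∈ bravaisLattice B, (R ^ 3)⁻¹ * φ₀ (R⁻¹ • y)) else 0)|
        ≤ C / R ^ 3 := by
  let T : (Fin 3 → ℝ) →L[ℝ] (Fin 3 → ℝ) := B.mulVecLin.toContinuousLinearMap
  have hT : ∀ x, T x = B.mulVec x := fun _ => rfl
  let T' : (Fin 3 → ℝ) →L[ℝ] (Fin 3 → ℝ) := (B⁻¹).mulVecLin.toContinuousLinearMap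
  have hTT' : ∀ x, T (T' x) = x := fun x => by
    change B.mulVec (B⁻¹.mulVec x) = x
    rw [Matrix.mulVec_mulVec, Matrix.mul_nonsing_inv _ hB, Matrix.one_mulVec]
  have hT'T : ∀ x, T' (T x) = x := fun x => by
    change B⁻¹.mulVec (B.mulVec x) = x
    rw [Matrix.mulVec_mulVec, Matrix.nonsing_inv_mul _ hB, Matrix.one_mulVec]
  have compact_comp : ∀ f : (Fin 3 → ℝ) → ℝ, HasCompactSupport f →
      HasCompactSupport fun x => f (T x) := fun f hf =>
    HasCompactSupport.intro (hf.isCompact.image T'.continuous) fun x hx =>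
      image_eq_zero_of_notMem_tsupport fun h => hx ⟨T x, h, hT'T x⟩
  let F : Fin 3 → (Fin 3 → ℝ) → ℝ := fun β x => φ₀ (T x) * T x β
  have hFsm : ∀ β, ContDiff ℝ (⊤ : ℕ∞) (F β) := fun β =>
    (hφ.comp T.contDiff).mul ((contDiff_apply ℝ ℝ β).comp T.contDiff)
  have hFc : ∀ β, HasCompactSupport (F β) := fun β => (compact_comp φ₀ hc).mul_right
  choose C hC using fun α β => exists_abs_finsum_fderiv_le (hFsm β) (hFc β) (T' (Pi.single α 1))
  have hC0 : ∀ α β, 0 ≤ C α β := fun α β => (abs_nonneg _).trans (hC α β 1 le_rfl)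
  refine ⟨∑ α, ∑ β, C α β, fun R hR α β => ?_⟩
  have hR0 : 0 < R := one_pos.trans_le hR
  have hCle : C α β ≤ ∑ α, ∑ β, C α β :=
    (Finset.single_le_sum (f := fun β => C α β) (fun β _ => hC0 α β) (Finset.mem_univ β)).trans
      (Finset.single_le_sum (f := fun α => ∑ β, C α β)
        (fun α _ => Finset.sum_nonneg fun β _ => hC0 α β) (Finset.mem_univ α))
  have hdφ : ∀ x, DifferentiableAt ℝ φ₀ x := hφ.differentiable (by simp)
  have hscale : ∀ x, fderiv ℝ (fun z => (R ^ 3)⁻¹ * φ₀ (R⁻¹ • z)) (T x) (Pi.single α 1) * T x β =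
      (R ^ 3)⁻¹ * (fderiv ℝ φ₀ (T (R⁻¹ • x)) (Pi.single α 1) * T (R⁻¹ • x) β) := fun x => by
    have h1 : HasFDerivAt (fun z : Fin 3 → ℝ => R⁻¹ • z)
        (R⁻¹ • ContinuousLinearMap.id ℝ (Fin 3 → ℝ)) (T x) :=
      (hasFDerivAt_id (T x)).const_smul R⁻¹
    have h2 := ((hdφ (R⁻¹ • T x)).hasFDerivAt.comp (T x) h1).const_mul (R ^ 3)⁻¹
    have h3 := h2.fderiv
    simp only [Function.comp_def] at h3
    rw [h3]
    simp only [map_smul, smul_apply, ContinuousLinearMap.comp_apply,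
      ContinuousLinearMap.id_apply, smul_eq_mul, Pi.smul_apply]
    ring
  have hprod : ∀ x, fderiv ℝ (F β) x (T' (Pi.single α 1)) =
      fderiv ℝ φ₀ (T x) (Pi.single α 1) * T x β + if α = β then φ₀ (T x) else 0 := fun x => by
    have h1 := (hdφ (T x)).hasFDerivAt.comp x T.hasFDerivAt
    have h2 : HasFDerivAt (fun x => T x β)
        ((ContinuousLinearMap.proj (R := ℝ) (φ := fun _ : Fin 3 => ℝ) β).comp T) x :=
      ((ContinuousLinearMap.proj (R := ℝ) (φ := fun _ : Fin 3 => ℝ) β).comp T).hasFDerivAt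
    have h3 := (h1.mul h2).fderiv
    change fderiv ℝ (F β) x = _ at h3
    rw [h3]
    simp only [add_apply, smul_apply,
      ContinuousLinearMap.comp_apply, hTT', ContinuousLinearMap.proj_apply, smul_eq_mul,
      Function.comp_apply, Pi.single_apply, eq_comm (a := β)]
    split_ifs <;> ring
  have hfin1 : (Function.support fun n : Fin 3 → ℤ =>
      fderiv ℝ φ₀ (T (R⁻¹ • fun k => (n k : ℝ))) (Pi.single α 1) *
        T (R⁻¹ • fun k => (n k : ℝ)) β).Finite :=
    finite_support_comp_inv_smul_intCast
      (F := fun x => fderiv ℝ φ₀ (T x) (Pi.single α 1) * T x β)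
      (compact_comp _ (hc.fderiv_apply ℝ (Pi.single α 1))).mul_right hR0
  have hfin2 : (Function.support fun n : Fin 3 → ℤ =>
      φ₀ (T (R⁻¹ • fun k => (n k : ℝ)))).Finite :=
    finite_support_comp_inv_smul_intCast (F := fun x => φ₀ (T x)) (compact_comp _ hc) hR0
  have hmain : (- ∑ᶠ y ∈ bravaisLattice B,
      fderiv ℝ (fun z => (R ^ 3)⁻¹ * φ₀ (R⁻¹ • z)) y (Pi.single α 1) * y β)
        - (if α = β then (∑ᶠ y ∈ bravaisLattice B, (R ^ 3)⁻¹ * φ₀ (R⁻¹ • y)) else 0) =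
      -((R ^ 3)⁻¹ * ∑ᶠ n : Fin 3 → ℤ,
        fderiv ℝ (F β) (R⁻¹ • fun k => (n k : ℝ)) (T' (Pi.single α 1))) := by
    simp_rw [finsum_mem_bravaisLattice hB, ← hT, hscale, ← map_smul, hprod]
    rw [← mul_finsum, ← mul_finsum]
    split_ifs with hαβ
    · rw [finsum_add_distrib hfin1 hfin2]
      ring
    · simp
  rw [hmain, abs_neg, abs_mul, abs_of_pos (by positivity), div_eq_inv_mul]
  gcongr
  exact (hC α β R hR).trans hCle
end

section
/- Let L = {B n : n ∈ ℤ³} be a Bravais lattice in ℝ³ with B an invertible real 3×3 matrix and unit-cell volume Ω₀ = |det B|, and let φ₀ : ℝ³ → ℝ be a smooth (C^∞) kernel (compactly supported, φ₀(−x) = φ₀(x)) with ∫_{ℝ³} φ₀ = 1. For ε ∈ (0,1] and R ≥ 1, consider the rescaled lattice εL = {εy : y ∈ L} and the kernel κ(x) = (εR)^{−3} φ₀(x/(εR)), and suppose the first moment condition Σ_{y∈εL} κ(y) = 1/(ε³Ω₀) holds. For w : ℝ³ → ℝ define the sampled gradient G(x) = −ε³Ω₀ Σ_{y∈εL} ∇κ(y)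 w(x + y) ∈ ℝ³. Then there exists a constant C, depending only on φ₀ and B, such that for every three times continuously differentiable w whose first-order partial derivatives are bounded in absolute value by M₁ and whose third-order partial derivatives are bounded in absolute value by M₃, and every x ∈ ℝ³: ‖G(x) − ∇w(x)‖ ≤ C ( M₁ R^{−3} + M₃ ε² R² ). -/
open scoped BigOperators

/-- The real vector with the given integer coordinates. -/
def intVec (n : Fin 3 → ℤ) : Fin 3 → ℝ := fun k => (n k : ℝ)

lemma intVec_neg (n : Fin 3 → ℤ) : intVec (-n) = -intVec n := by
  ext k; simp [intVec]

lemma intVec_add (m n : Fin 3 → ℤ) : intVec (m + n) = intVec m + intVec n := by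
  ext k; simp [intVec]

lemma intVec_single (i : Fin 3) : intVec (Pi.single i 1) = Pi.single i 1 := by
  ext k; by_cases hk : k = i
  · subst hk; simp [intVec]
  · simp [intVec, hk]

lemma intVec_injective : Function.Injective intVec := fun m n hmn => by
  ext k; have := congrFun hmn k; simpa [intVec] using this

/-- The integer points `n` such that `n + c` lies in the sup-norm ball of radius `r`. -/
noncomputable def intBox (c : Fin 3 → ℝ) (r : ℝ) : Finset (Fin 3 → ℤ) :=
  Fintype.piFinset fun i => Finset.Icc ⌈-r - c i⌉ ⌊r - c i⌋

lemma mem_intBox {c : Fin 3 → ℝ} {r : ℝ} (n : Fin 3 → ℤ) (h : ‖intVec n + c‖ ≤ r) :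
    n ∈ intBox c r := by
  have hr : 0 ≤ r := (norm_nonneg _).trans h
  rw [pi_norm_le_iff_of_nonneg hr] at h
  simp only [intBox, Fintype.mem_piFinset, Finset.mem_Icc]
  intro i
  have hi := abs_le.mp (h i)
  simp only [intVec, Pi.add_apply] at hi
  rw [Int.ceil_le, Int.le_floor]
  constructor <;> linarith [hi.1, hi.2]

lemma card_intBox_le (c : Fin 3 → ℝ) {r : ℝ} (hr : 0 ≤ r) :
    ((intBox c r).card : ℝ) ≤ (2 * r + 1) ^ 3 := by
  rw [intBox, Fintype.card_piFinset]
  push_cast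
  calc ∏ i, ((Finset.Icc ⌈-r - c i⌉ ⌊r - c i⌋).card : ℝ) ≤ ∏ _i : Fin 3, (2 * r + 1) := by
        refine Finset.prod_le_prod (fun i _ => by positivity) fun i _ => ?_
        rw [Int.card_Icc]
        have h1 := Int.floor_le (r - c i)
        have h2 := Int.le_ceil (-r - c i)
        have h3 : (((⌊r - c i⌋ + 1 - ⌈-r - c i⌉).toNat : ℤ) : ℝ)
            = ((max (⌊r - c i⌋ + 1 - ⌈-r - c i⌉) 0 : ℤ) : ℝ) := by rw [Int.toNat_eq_max]
        rw [Int.cast_natCast] at h3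
        rw [h3]
        push_cast
        apply max_le <;> linarith
    _ = (2 * r + 1) ^ 3 := by simp

section Support

variable {g : (Fin 3 → ℝ) → ℝ} {ρ h : ℝ}

lemma mem_intBox_of_ne_zero (hg : ∀ z, g z ≠ 0 → ‖z‖ ≤ ρ) (hh : 0 < h) (t : Fin 3 → ℝ)
    (n : Fin 3 → ℤ) (hn : g (h • (intVec n + t)) ≠ 0) : n ∈ intBox t (ρ / h) := by
  apply mem_intBox
  have := hg _ hn
  rw [norm_smul, Real.norm_of_nonneg hh.le] at this
  rwa [le_div_iff₀' hh]

lemma mem_intBox_add_of_ne_zero (hg : ∀ z, g z ≠ 0 → ‖z‖ ≤ ρ) (hh : 0 < h)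
    (t s : Fin 3 → ℝ) (hs : ‖s‖ ≤ 1) (n : Fin 3 → ℤ)
    (hn : g (h • (intVec n + (t + s))) ≠ 0) : n ∈ intBox t (ρ / h + 1) := by
  apply mem_intBox
  have := hg _ hn
  rw [norm_smul, Real.norm_of_nonneg hh.le, ← le_div_iff₀' hh] at this
  calc ‖intVec n + t‖ = ‖(intVec n + (t + s)) - s‖ := by congr 1; abel
    _ ≤ ‖intVec n + (t + s)‖ + ‖s‖ := norm_sub_le _ _
    _ ≤ ρ / h + 1 := by linarith

lemma finsum_eq_sum_intBox_add (hg : ∀ z, g z ≠ 0 → ‖z‖ ≤ ρ) (hh : 0 < h)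
    (t s : Fin 3 → ℝ) (hs : ‖s‖ ≤ 1) :
    ∑ᶠ n : Fin 3 → ℤ, g (h • (intVec n + (t + s)))
      = ∑ n ∈ intBox t (ρ / h + 1), g (h • (intVec n + (t + s))) :=
  finsum_eq_sum_of_support_subset _ fun n hn => mem_intBox_add_of_ne_zero hg hh t s hs n hn

lemma abs_finsum_le {u : (Fin 3 → ℤ) → ℝ} {M r : ℝ} (hr : 0 ≤ r) (hM : 0 ≤ M)
    (c : Fin 3 → ℝ) (hu : ∀ n, u n ≠ 0 → n ∈ intBox c r) (hb : ∀ n, |u n| ≤ M) :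
    |∑ᶠ n, u n| ≤ M * (2 * r + 1) ^ 3 := by
  rw [finsum_eq_sum_of_support_subset u (s := intBox c r) fun n hn => hu n hn]
  calc |∑ n ∈ intBox c r, u n| ≤ ∑ n ∈ intBox c r, |u n| := Finset.abs_sum_le_sum_abs _ _
    _ ≤ ∑ _n ∈ intBox c r, M := Finset.sum_le_sum fun n _ => hb n
    _ = (intBox c r).card * M := by simp
    _ ≤ (2 * r + 1) ^ 3 * M := by gcongr; exact card_intBox_le c hr
    _ = _ := mul_comm _ _

lemma two_mul_div_add_one_pow_le (hρ : 0 ≤ ρ) (hh : h ∈ Set.Ioc (0 : ℝ) 1) :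
    (2 * (ρ / h) + 1) ^ 3 ≤ (2 * ρ + 1) ^ 3 / h ^ 3 := by
  rw [← div_pow]
  have : 1 ≤ 1 / h := by rw [le_div_iff₀ hh.1]; linarith [hh.2]
  have h0 := div_nonneg hρ hh.1.le
  apply pow_le_pow_left₀ (by positivity)
  rw [add_div, mul_div_assoc]
  linarith

end Support

lemma abs_sub_le_of_hasDerivAt {g g' : ℝ → ℝ} {K : ℝ} (hg : ∀ s, HasDerivAt g (g' s) s)
    (hK : ∀ s ∈ Set.Icc (0 : ℝ) 1, |g' s| ≤ K) {s t : ℝ} (hs : s ∈ Set.Icc (0 : ℝ) 1)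
    (ht : t ∈ Set.Icc (0 : ℝ) 1) : |g t - g s| ≤ K := by
  have hK0 : 0 ≤ K := (abs_nonneg _).trans (hK s hs)
  have := Convex.norm_image_sub_le_of_norm_hasDerivWithin_le (f := g) (f' := g') (C := K)
    (fun x _ => (hg x).hasDerivWithinAt) hK (convex_Icc 0 1) hs ht
  calc |g t - g s| ≤ K * |t - s| := this
    _ ≤ K * 1 := by
        gcongr
        rw [abs_le]; constructor <;> linarith [hs.1, hs.2, ht.1, ht.2]
    _ = K := mul_one K

/-- A function with equal values at the end points of `[0,1]` has a derivative bounded by the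
supremum of its second derivative. -/
lemma abs_deriv_le_of_eq_endpoints {g g' g'' : ℝ → ℝ} {K : ℝ} (hg : ∀ s, HasDerivAt g (g' s) s)
    (hg' : ∀ s, HasDerivAt g' (g'' s) s) (hper : g 0 = g 1)
    (hK : ∀ s ∈ Set.Icc (0 : ℝ) 1, |g'' s| ≤ K) : ∀ s ∈ Set.Icc (0 : ℝ) 1, |g' s| ≤ K := by
  intro s hs
  obtain ⟨c, hc, hc0⟩ := exists_hasDerivAt_eq_zero (f := g) (f' := g') zero_lt_one
    (fun x _ => (hg x).continuousAt.continuousWithinAt) hper fun x _ => hg x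
  have := abs_sub_le_of_hasDerivAt hg' hK (Set.Ioo_subset_Icc_self hc) hs
  rwa [hc0, sub_zero] at this

/-- The derivative of `f` in the direction `v`. -/
noncomputable def dirDeriv (v : Fin 3 → ℝ) (f : (Fin 3 → ℝ) → ℝ) : (Fin 3 → ℝ) → ℝ :=
  fun z => fderiv ℝ f z v

lemma contDiff_dirDeriv (v : Fin 3 → ℝ) {f : (Fin 3 → ℝ) → ℝ} (hf : ContDiff ℝ (⊤ : ℕ∞) f) :
    ContDiff ℝ (⊤ : ℕ∞) (dirDeriv v f) :=
  (hf.fderiv_right (by simp)).clm_apply contDiff_const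

lemma dirDeriv_support {v : Fin 3 → ℝ} {f : (Fin 3 → ℝ) → ℝ} {ρ : ℝ}
    (hf : ∀ z, f z ≠ 0 → ‖z‖ ≤ ρ) : ∀ z, dirDeriv v f z ≠ 0 → ‖z‖ ≤ ρ := by
  intro z hz
  have h1 : z ∈ Function.support (fderiv ℝ f) := by
    intro h0; exact hz (by simp [dirDeriv, h0])
  have h2 : tsupport f ⊆ Metric.closedBall 0 ρ :=
    closure_minimal (fun z hz => by simpa using hf z hz) Metric.isClosed_closedBall
  simpa using h2 (support_fderiv_subset ℝ h1)

lemma exists_bound_of_support {f : (Fin 3 → ℝ) → ℝ} {ρ : ℝ} (hf : Continuous f)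
    (hs : ∀ z, f z ≠ 0 → ‖z‖ ≤ ρ) : ∃ M, 0 ≤ M ∧ ∀ z, |f z| ≤ M := by
  have hcs : HasCompactSupport f :=
    HasCompactSupport.intro (isCompact_closedBall (0 : Fin 3 → ℝ) ρ) fun z hz => by
      by_contra h0; exact hz (by simpa using hs z h0)
  obtain ⟨M, hM⟩ := hcs.exists_bound_of_continuous hf
  exact ⟨M, (norm_nonneg _).trans (hM 0), hM⟩

lemma finsum_shift_single (g : (Fin 3 → ℝ) → ℝ) (h : ℝ) (t : Fin 3 → ℝ) (i : Fin 3) :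
    ∑ᶠ n : Fin 3 → ℤ, g (h • (intVec n + (t + Pi.single i 1)))
      = ∑ᶠ n : Fin 3 → ℤ, g (h • (intVec n + t)) := by
  rw [← finsum_comp_equiv (Equiv.addRight (Pi.single i 1 : Fin 3 → ℤ))
    (f := fun n => g (h • (intVec n + t)))]
  refine finsum_congr fun n => ?_
  rw [Equiv.coe_addRight, intVec_add, intVec_single]
  congr 2
  abel

lemma norm_smul_single_le (i : Fin 3) {s : ℝ} (hs : s ∈ Set.Icc (0 : ℝ) 1) :
    ‖s • (Pi.single i 1 : Fin 3 → ℝ)‖ ≤ 1 := by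
  rw [norm_smul, Pi.norm_single, norm_one, mul_one, Real.norm_of_nonneg hs.1]
  exact hs.2

/-- Lattice sums of a smooth function of bounded support oscillate, along a coordinate
direction, by a quantity independent of the scale. -/
lemma exists_abs_finsum_sub_le_single {f : (Fin 3 → ℝ) → ℝ} {ρ : ℝ} (hρ : 0 ≤ ρ)
    (hf : ContDiff ℝ (⊤ : ℕ∞) f) (hs : ∀ z, f z ≠ 0 → ‖z‖ ≤ ρ) (i : Fin 3) :
    ∃ K, ∀ h ∈ Set.Ioc (0 : ℝ) 1, ∀ t : Fin 3 → ℝ, ∀ s ∈ Set.Icc (0 : ℝ) 1,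
      |∑ᶠ n : Fin 3 → ℤ, f (h • (intVec n + (t + s • Pi.single i 1)))
        - ∑ᶠ n : Fin 3 → ℤ, f (h • (intVec n + t))| ≤ K := by
  set e : Fin 3 → ℝ := Pi.single i 1 with he
  set F : ℕ → (Fin 3 → ℝ) → ℝ := fun k => (dirDeriv e)^[k] f with hF
  have hsucc : ∀ k, F (k + 1) = dirDeriv e (F k) := fun k => Function.iterate_succ_apply' _ _ _
  have hFc : ∀ k, ContDiff ℝ (⊤ : ℕ∞) (F k) := by
    intro k
    induction k with
    | zero => exact hf
    | succ k ih => rw [hsucc]; exact contDiff_dirDeriv e ih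
  have hFs : ∀ k, ∀ z, F k z ≠ 0 → ‖z‖ ≤ ρ := by
    intro k
    induction k with
    | zero => exact hs
    | succ k ih => rw [hsucc]; exact dirDeriv_support ih
  obtain ⟨M, hM0, hM⟩ := exists_bound_of_support (hFc 3).continuous (hFs 3)
  refine ⟨M * (2 * ρ + 1) ^ 3, fun h hh t s hst => ?_⟩
  set S := intBox t (ρ / h + 1)
  set g : ℕ → ℝ → ℝ := fun k s => h ^ k * ∑ n ∈ S, F k (h • (intVec n + (t + s • e))) with hg
  have hgd : ∀ k s, HasDerivAt (g k) (g (k + 1) s) s := by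
    intro k s
    have h1 : ∀ n, HasDerivAt (fun s : ℝ => F k (h • (intVec n + (t + s • e))))
        (h * F (k + 1) (h • (intVec n + (t + s • e)))) s := by
      intro n
      have h2 : HasDerivAt (fun s : ℝ => h • (intVec n + (t + s • e))) (h • ((1 : ℝ) • e)) s :=
        ((((hasDerivAt_id s).smul_const e).const_add t).const_add (intVec n)).const_smul h
      have h3 := (((hFc k).differentiable (by simp)) (h • (intVec n + (t + s • e)))).hasFDerivAt
      have h4 := h3.comp_hasDerivAt s h2
      refine h4.congr_deriv ?_
      simp [hsucc, dirDeriv]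
    have h5 := (HasDerivAt.fun_sum (u := S) fun n _ => h1 n).const_mul (h ^ k)
    refine h5.congr_deriv ?_
    simp only [hg]
    rw [← Finset.mul_sum]
    ring
  have hgf : ∀ k, ∀ s ∈ Set.Icc (0 : ℝ) 1,
      g k s = h ^ k * ∑ᶠ n : Fin 3 → ℤ, F k (h • (intVec n + (t + s • e))) := by
    intro k s hs
    rw [finsum_eq_sum_intBox_add (hFs k) hh.1 t (s • e) (norm_smul_single_le i hs)]
  have hper : ∀ k, g k 0 = g k 1 := by
    intro k
    rw [hgf k 0 (by simp), hgf k 1 (by simp), one_smul, zero_smul, add_zero, he,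
      finsum_shift_single]
  have h3 : ∀ s ∈ Set.Icc (0 : ℝ) 1, |g 3 s| ≤ M * (2 * ρ + 1) ^ 3 := by
    intro s hs
    rw [hgf 3 s hs, abs_mul, abs_of_pos (pow_pos hh.1 3)]
    have h6 := abs_finsum_le (u := fun n => F 3 (h • (intVec n + (t + s • e))))
      (div_nonneg hρ hh.1.le) hM0 (t + s • e)
      (fun n hn => mem_intBox_of_ne_zero (hFs 3) hh.1 _ n hn) fun n => hM _
    have h7 := two_mul_div_add_one_pow_le hρ hh
    have hh3 := pow_pos hh.1 3
    have hh0 := hh.1.ne'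
    calc h ^ 3 * _ ≤ h ^ 3 * (M * ((2 * ρ + 1) ^ 3 / h ^ 3)) := by
          gcongr
          exact h6.trans (by gcongr)
      _ = M * (2 * ρ + 1) ^ 3 := by field_simp
  have h2 := abs_deriv_le_of_eq_endpoints (hgd 1) (hgd 2) (hper 1) h3
  have h1 := abs_deriv_le_of_eq_endpoints (hgd 0) (hgd 1) (hper 0) h2
  have h0 := abs_sub_le_of_hasDerivAt (hgd 0) h1 (s := 0) (by simp) hst
  rw [hgf 0 0 (by simp), hgf 0 s hst] at h0
  simpa [hF] using h0

lemma exists_abs_finsum_sub_le {f : (Fin 3 → ℝ) → ℝ} {ρ : ℝ} (hρ : 0 ≤ ρ)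
    (hf : ContDiff ℝ (⊤ : ℕ∞) f) (hs : ∀ z, f z ≠ 0 → ‖z‖ ≤ ρ) :
    ∃ K, ∀ h ∈ Set.Ioc (0 : ℝ) 1, ∀ t : Fin 3 → ℝ, (∀ i, t i ∈ Set.Icc (0 : ℝ) 1) →
      |∑ᶠ n : Fin 3 → ℤ, f (h • (intVec n + t)) - ∑ᶠ n : Fin 3 → ℤ, f (h • intVec n)| ≤ K := by
  choose K hK using exists_abs_finsum_sub_le_single hρ hf hs
  refine ⟨K 0 + K 1 + K 2, fun h hh t ht => ?_⟩
  have h0 := hK 0 h hh 0 (t 0) (ht 0)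
  have h1 := hK 1 h hh (0 + t 0 • Pi.single 0 1) (t 1) (ht 1)
  have h2 := hK 2 h hh (0 + t 0 • Pi.single 0 1 + t 1 • Pi.single 1 1) (t 2) (ht 2)
  have h3 : (0 + t 0 • Pi.single 0 1 + t 1 • Pi.single 1 1 + t 2 • Pi.single 2 1 : Fin 3 → ℝ)
      = t := by
    ext i; fin_cases i <;> simp
  rw [h3] at h2
  simp only [add_zero] at h0
  rw [abs_le] at *
  constructor <;> linarith [h0.1, h0.2, h1.1, h1.2, h2.1, h2.2]

/-- The half-open unit cube with corner `n`. -/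
def unitCube (n : Fin 3 → ℤ) : Set (Fin 3 → ℝ) :=
  Set.univ.pi fun i => Set.Ico (n i : ℝ) (n i + 1)

lemma mem_unitCube {n : Fin 3 → ℤ} {x : Fin 3 → ℝ} :
    x ∈ unitCube n ↔ (fun i => ⌊x i⌋) = n := by
  simp [unitCube, funext_iff, Int.floor_eq_iff]

lemma measurableSet_unitCube (n : Fin 3 → ℤ) : MeasurableSet (unitCube n) :=
  MeasurableSet.univ_pi fun _ => measurableSet_Ico

lemma volume_unitCube (n : Fin 3 → ℤ) : MeasureTheory.volume (unitCube n) = 1 := by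
  simp [unitCube, Real.volume_pi_Ico]

open MeasureTheory in
lemma hasSum_setIntegral_unitCube {f : (Fin 3 → ℝ) → ℝ} (hf : Integrable f) :
    HasSum (fun n => ∫ x in unitCube 0, f (intVec n + x)) (∫ x, f x) := by
  have hU : (⋃ n, unitCube n) = Set.univ :=
    Set.eq_univ_of_forall fun x => Set.mem_iUnion.2 ⟨_, mem_unitCube.2 rfl⟩
  have h1 := hasSum_integral_iUnion (f := f) (μ := volume) measurableSet_unitCube
    (fun m n hmn => Set.disjoint_left.2 fun x hm hn =>
      hmn ((mem_unitCube.1 hm).symm.trans (mem_unitCube.1 hn))) hf.integrableOn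
  rw [hU, setIntegral_univ] at h1
  have h2 : ∀ n, ∫ x in unitCube 0, f (intVec n + x) = ∫ x in unitCube n, f x := by
    intro n
    rw [← (measurePreserving_add_left volume (intVec n)).setIntegral_preimage_emb
      (measurableEmbedding_addLeft _) f (unitCube n)]
    congr 2
    ext x
    simp [unitCube, intVec, add_comm (n _ : ℝ)]
  simpa only [h2] using h1

open MeasureTheory in
/-- Riemann sums over a cubic grid of a smooth function of bounded support converge to the
integral at cubic rate. -/
lemma exists_abs_riemannSum_sub_integral_le {f : (Fin 3 → ℝ) → ℝ} {ρ : ℝ} (hρ : 0 ≤ ρ)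
    (hf : ContDiff ℝ (⊤ : ℕ∞) f) (hs : ∀ z, f z ≠ 0 → ‖z‖ ≤ ρ) :
    ∃ K, ∀ h ∈ Set.Ioc (0 : ℝ) 1,
      |h ^ 3 * ∑ᶠ n : Fin 3 → ℤ, f (h • intVec n) - ∫ x, f x| ≤ K * h ^ 3 := by
  obtain ⟨K, hK⟩ := exists_abs_finsum_sub_le hρ hf hs
  refine ⟨K, fun h hh => ?_⟩
  set S := intBox 0 (ρ / h + 1)
  have hcont : Continuous fun x => f (h • x) := hf.continuous.comp (continuous_const_smul h)
  have hcs : HasCompactSupport fun x => f (h • x) :=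
    HasCompactSupport.intro (isCompact_closedBall (0 : Fin 3 → ℝ) (ρ / h)) fun z hz => by
      by_contra h0
      have := hs _ h0
      rw [norm_smul, Real.norm_of_nonneg hh.1.le, ← le_div_iff₀' hh.1] at this
      exact hz (by simpa using this)
  have hnorm : ∀ x ∈ unitCube 0, (∀ i, x i ∈ Set.Icc (0 : ℝ) 1) := by
    intro x hx i
    have := hx i trivial
    simp only [Pi.zero_apply, Int.cast_zero, zero_add] at this
    exact ⟨this.1, this.2.le⟩
  have hnorm' : ∀ x ∈ unitCube 0, ‖x‖ ≤ 1 := by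
    intro x hx
    rw [pi_norm_le_iff_of_nonneg zero_le_one]
    intro i
    rw [Real.norm_of_nonneg (hnorm x hx i).1]
    exact (hnorm x hx i).2
  have hsum : ∀ x ∈ unitCube 0, ∑ᶠ n : Fin 3 → ℤ, f (h • (intVec n + x))
      = ∑ n ∈ S, f (h • (intVec n + x)) := by
    intro x hx
    have := finsum_eq_sum_intBox_add hs hh.1 0 x (hnorm' x hx)
    simpa using this
  have hint : ∀ n, IntegrableOn (fun x => f (h • (intVec n + x))) (unitCube 0) := fun n =>
    ((hcont.integrable_of_hasCompactSupport hcs).comp_add_left (intVec n)).integrableOn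
  have h1 : ∫ x, f (h • x) = ∫ x in unitCube 0, ∑ n ∈ S, f (h • (intVec n + x)) := by
    rw [integral_finsetSum _ fun n _ => hint n]
    refine (hasSum_setIntegral_unitCube
      (hcont.integrable_of_hasCompactSupport hcs)).unique (hasSum_sum_of_ne_finset_zero ?_)
    intro n hn
    refine setIntegral_eq_zero_of_forall_eq_zero fun x hx => ?_
    by_contra h0
    refine hn (mem_intBox_add_of_ne_zero hs hh.1 0 x (hnorm' x hx) n ?_)
    simpa using h0
  have h2 : |∑ᶠ n : Fin 3 → ℤ, f (h • intVec n) - ∫ x, f (h • x)| ≤ K := by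
    set A := ∑ᶠ n : Fin 3 → ℤ, f (h • intVec n)
    have h3 : ∫ x in unitCube 0, (A - ∑ n ∈ S, f (h • (intVec n + x)))
        = A - ∫ x, f (h • x) := by
      have hA : IntegrableOn (fun _ => A) (unitCube 0) :=
        integrableOn_const (by simp [volume_unitCube])
      rw [integral_sub hA (integrable_finsetSum _ fun n _ => hint n), h1]
      simp [Measure.real, volume_unitCube]
    rw [← h3]
    have h4 := norm_setIntegral_le_of_norm_le_const (μ := volume) (s := unitCube 0) (C := K)
      (f := fun x => A - ∑ n ∈ S, f (h • (intVec n + x))) (by simp [volume_unitCube]) ?_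
    · simpa [Measure.real, volume_unitCube] using h4
    · intro x hx
      rw [← hsum x hx, norm_sub_rev]
      exact hK h hh x (hnorm x hx)
  rw [Measure.integral_comp_smul] at h2
  have hh3 := pow_pos hh.1 3
  have hh0 := hh.1.ne'
  simp only [Module.finrank_fintype_fun_eq_card, Fintype.card_fin, smul_eq_mul] at h2
  rw [abs_of_pos (inv_pos.2 hh3)] at h2
  calc _ = |h ^ 3 * (∑ᶠ n : Fin 3 → ℤ, f (h • intVec n) - (h ^ 3)⁻¹ * ∫ x, f x)| := by
        congr 1; field_simp
    _ = h ^ 3 * _ := by rw [abs_mul, abs_of_pos hh3]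
    _ ≤ h ^ 3 * K := by gcongr
    _ = _ := mul_comm _ _

lemma abs_iteratedFDeriv_three_le {w : (Fin 3 → ℝ) → ℝ} {M : ℝ} {z : Fin 3 → ℝ}
    (hM : ∀ idx : Fin 3 → Fin 3,
      |iteratedFDeriv ℝ 3 w z (fun k => Pi.single (idx k) 1)| ≤ M) (y : Fin 3 → ℝ) :
    |iteratedFDeriv ℝ 3 w z (fun _ => y)| ≤ 27 * M * ‖y‖ ^ 3 := by
  have hy : (fun _ : Fin 3 => y)
      = fun _ => ∑ j, y j • (Pi.single j 1 : Fin 3 → ℝ) := by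
    funext _; exact pi_eq_sum_univ' y
  have hM0 : 0 ≤ M := (abs_nonneg _).trans (hM 0)
  rw [hy, ContinuousMultilinearMap.map_sum]
  calc _ ≤ ∑ r : Fin 3 → Fin 3, |iteratedFDeriv ℝ 3 w z
          (fun i => y (r i) • (Pi.single (r i) 1 : Fin 3 → ℝ))| := Finset.abs_sum_le_sum_abs _ _
    _ ≤ ∑ _r : Fin 3 → Fin 3, ‖y‖ ^ 3 * M := by
        refine Finset.sum_le_sum fun r _ => ?_
        rw [ContinuousMultilinearMap.map_smul_univ, smul_eq_mul, abs_mul, Finset.abs_prod]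
        refine mul_le_mul ?_ (hM r) (abs_nonneg _) (by positivity)
        calc ∏ i, |y (r i)| ≤ ∏ _i : Fin 3, ‖y‖ :=
              Finset.prod_le_prod (fun _ _ => abs_nonneg _) fun i _ => norm_le_pi_norm y (r i)
          _ = ‖y‖ ^ 3 := by simp
    _ = 27 * M * ‖y‖ ^ 3 := by
        simp only [Finset.sum_const, Finset.card_univ, Fintype.card_pi, Fintype.card_fin,
          Finset.prod_const, nsmul_eq_mul]
        norm_num
        ring

lemma hasDerivAt_iteratedFDeriv_line {w : (Fin 3 → ℝ) → ℝ} (hw : ContDiff ℝ 3 w)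
    (x y : Fin 3 → ℝ) (c : ℝ) {k : ℕ} (hk : k < 3) (s : ℝ) :
    HasDerivAt (fun s : ℝ => iteratedFDeriv ℝ k w (x + (c * s) • y) (fun _ => y))
      (c * iteratedFDeriv ℝ (k + 1) w (x + (c * s) • y) (fun _ => y)) s := by
  have h1 : HasDerivAt (fun s : ℝ => x + (c * s) • y) ((c * 1) • y) s :=
    (((hasDerivAt_id s).const_mul c).smul_const y).const_add x
  have h2 := (hw.differentiable_iteratedFDeriv (m := k) (by exact_mod_cast hk)
    (x + (c * s) • y)).hasFDerivAt.comp_hasDerivAt s h1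
  have h3 := (ContinuousMultilinearMap.apply ℝ (fun _ : Fin k => Fin 3 → ℝ) ℝ
    (fun _ => y)).hasFDerivAt.comp_hasDerivAt s h2
  refine h3.congr_deriv ?_
  rw [iteratedFDeriv_succ_apply_left]
  simp [Fin.tail_def]

/-- Third order accuracy of the symmetric difference quotient. -/
lemma abs_symm_difference_sub_le {w : (Fin 3 → ℝ) → ℝ} {M : ℝ} (hw : ContDiff ℝ 3 w)
    (hM : ∀ (x : Fin 3 → ℝ) (idx : Fin 3 → Fin 3),
      |iteratedFDeriv ℝ 3 w x (fun k => Pi.single (idx k) 1)| ≤ M) (x y : Fin 3 → ℝ) :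
    |w (x + y) - w (x - y) - 2 * fderiv ℝ w x y| ≤ 54 * M * ‖y‖ ^ 3 := by
  set D : ℕ → ℝ → ℝ → ℝ := fun k c s =>
    iteratedFDeriv ℝ k w (x + (c * s) • y) (fun _ => y) with hD
  have hd : ∀ c s, ∀ k < 3, HasDerivAt (D k c) (c * D (k + 1) c s) s := fun c s k hk =>
    hasDerivAt_iteratedFDeriv_line hw x y c hk s
  have hD0 : ∀ k c d, D k c 0 = D k d 0 := by intro k c d; simp [hD]
  have h3 : ∀ s ∈ Set.Icc (0 : ℝ) 1, |D 3 1 s + D 3 (-1) s| ≤ 54 * M * ‖y‖ ^ 3 := by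
    intro s _
    have ha := abs_iteratedFDeriv_three_le (hM (x + (1 * s) • y)) y
    have hb := abs_iteratedFDeriv_three_le (hM (x + (-1 * s) • y)) y
    exact (abs_add_le _ _).trans (by linarith)
  have h2 : ∀ s ∈ Set.Icc (0 : ℝ) 1, |D 2 1 s - D 2 (-1) s| ≤ 54 * M * ‖y‖ ^ 3 := by
    intro s hs
    have := abs_sub_le_of_hasDerivAt (g := fun s => D 2 1 s - D 2 (-1) s)
      (g' := fun s => D 3 1 s + D 3 (-1) s)
      (fun s => ((hd 1 s 2 (by norm_num)).sub (hd (-1) s 2 (by norm_num))).congr_deriv (by ring))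
      h3 (s := 0) (by simp) hs
    simpa [hD0 2 1 (-1)] using this
  have h1 : ∀ s ∈ Set.Icc (0 : ℝ) 1,
      |D 1 1 s + D 1 (-1) s - 2 * D 1 0 0| ≤ 54 * M * ‖y‖ ^ 3 := by
    intro s hs
    have := abs_sub_le_of_hasDerivAt (g := fun s => D 1 1 s + D 1 (-1) s)
      (g' := fun s => D 2 1 s - D 2 (-1) s)
      (fun s => ((hd 1 s 1 (by norm_num)).add (hd (-1) s 1 (by norm_num))).congr_deriv (by ring))
      h2 (s := 0) (by simp) hs
    simpa [hD0 1 1 0, hD0 1 (-1) 0, two_mul] using this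
  have h0 := abs_sub_le_of_hasDerivAt (g := fun s => D 0 1 s - D 0 (-1) s - s * (2 * D 1 0 0))
    (g' := fun s => D 1 1 s + D 1 (-1) s - 2 * D 1 0 0)
    (fun s => (((hd 1 s 0 (by norm_num)).sub (hd (-1) s 0 (by norm_num))).sub
      ((hasDerivAt_id s).mul_const (2 * D 1 0 0))).congr_deriv (by simp))
    h1 (s := 0) (t := 1) (by simp) (by simp)
  simpa [hD, sub_eq_add_neg] using h0

open MeasureTheory in
lemma abs_det_mul_integral_comp_mulVec {B : Matrix (Fin 3) (Fin 3) ℝ} (hB : B.det ≠ 0)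
    {F : (Fin 3 → ℝ) → ℝ} (hF : Continuous F) :
    |B.det| * ∫ z, F (B.mulVec z) = ∫ z, F z := by
  have h1 := Real.map_matrix_volume_pi_eq_smul_volume_pi hB
  have h2 : ∫ z, F (B.mulVec z) = ∫ z, F z ∂(Measure.map (Matrix.toLin' B) volume) := by
    rw [integral_map (LinearMap.continuous_of_finiteDimensional _).aemeasurable
      hF.aestronglyMeasurable]
    simp
  rw [h2, h1, integral_smul_measure, ENNReal.toReal_ofReal (abs_nonneg _), abs_inv, smul_eq_mul,
    mul_inv_cancel_left₀ (abs_ne_zero.2 hB)]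

open MeasureTheory in
/-- First moments of the partial derivatives of a kernel of unit mass. -/
lemma integral_dirDeriv_mul_coord {φ : (Fin 3 → ℝ) → ℝ} (hφ : ContDiff ℝ (⊤ : ℕ∞) φ)
    (hc : HasCompactSupport φ) (hint : ∫ x, φ x = 1) (α β : Fin 3) :
    ∫ z, dirDeriv (Pi.single α 1) φ z * z β = -(Pi.single α 1 : Fin 3 → ℝ) β := by
  have hcoord : ∀ (z v : Fin 3 → ℝ), fderiv ℝ (fun z : Fin 3 → ℝ => z β) z v = v β := by
    intro z v
    have h : HasFDerivAt (fun z : Fin 3 → ℝ => z β)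
        (ContinuousLinearMap.proj (R := ℝ) (φ := fun _ : Fin 3 => ℝ) β) z :=
      hasFDerivAt_apply β z
    rw [h.fderiv]
    rfl
  have hcβ : Continuous fun z : Fin 3 → ℝ => z β := continuous_apply β
  have hq : Continuous (dirDeriv (Pi.single α 1) φ) := (contDiff_dirDeriv _ hφ).continuous
  have hqc : HasCompactSupport (dirDeriv (Pi.single α 1) φ) := hc.fderiv_apply ℝ _
  have h := integral_mul_fderiv_eq_neg_fderiv_mul_of_integrable (μ := volume)
    (f := fun z : Fin 3 → ℝ => z β) (g := φ) (v := Pi.single α 1)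
    (by
      simp only [hcoord]
      exact (hφ.continuous.integrable_of_hasCompactSupport hc).const_mul _)
    ((hcβ.mul hq).integrable_of_hasCompactSupport hqc.mul_left)
    ((hcβ.mul hφ.continuous).integrable_of_hasCompactSupport hc.mul_left)
    (fun z _ => differentiableAt_apply β z)
    (fun z _ => hφ.differentiable (by simp) z)
  simp only [hcoord, integral_const_mul, hint, mul_one] at h
  rw [← h]
  exact integral_congr_ae (ae_of_all _ fun z => mul_comm _ _)

lemma fderiv_scaled_apply {φ : (Fin 3 → ℝ) → ℝ} (hφ : ContDiff ℝ (⊤ : ℕ∞) φ) (c a : ℝ)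
    (y v : Fin 3 → ℝ) :
    fderiv ℝ (fun z => c * φ (a • z)) y v = c * (a * dirDeriv v φ (a • y)) := by
  have h1 : HasFDerivAt (fun z : Fin 3 → ℝ => a • z)
      (a • ContinuousLinearMap.id ℝ (Fin 3 → ℝ)) y := (hasFDerivAt_id y).const_smul a
  have h2 := ((hφ.differentiable (by simp) (a • y)).hasFDerivAt.comp y h1).const_mul c
  have h3 : fderiv ℝ (fun z => c * φ (a • z)) y = _ := h2.fderiv
  rw [h3]
  simp [dirDeriv]

lemma dirDeriv_neg {φ : (Fin 3 → ℝ) → ℝ} (hφ : ContDiff ℝ (⊤ : ℕ∞) φ)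
    (hsymm : ∀ x, φ (-x) = φ x) (v z : Fin 3 → ℝ) :
    dirDeriv v φ (-z) = -dirDeriv v φ z := by
  have h := fderiv_scaled_apply hφ 1 (-1) z v
  simp only [neg_smul, one_smul, one_mul, hsymm, neg_one_mul] at h
  exact neg_eq_iff_eq_neg.1 h.symm

lemma image_smul_bravaisLattice (B : Matrix (Fin 3) (Fin 3) ℝ) (ε : ℝ) :
    (fun z : Fin 3 → ℝ => ε • z) '' bravaisLattice B
      = Set.range fun n : Fin 3 → ℤ => ε • B.mulVec (intVec n) := by
  ext y
  simp only [bravaisLattice, Set.mem_image, Set.mem_ofPred_eq, Set.mem_range]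
  constructor
  · rintro ⟨_, ⟨n, rfl⟩, rfl⟩
    exact ⟨n, rfl⟩
  · rintro ⟨n, rfl⟩
    exact ⟨_, ⟨n, rfl⟩, rfl⟩

lemma injective_smul_mulVec_intVec {B : Matrix (Fin 3) (Fin 3) ℝ} (hB : IsUnit B.det) {ε : ℝ}
    (hε : ε ≠ 0) : Function.Injective fun n : Fin 3 → ℤ => ε • B.mulVec (intVec n) :=
  fun _ _ hmn => intVec_injective (Matrix.mulVec_injective_of_isUnit
    ((Matrix.isUnit_iff_isUnit_det B).2 hB) (smul_right_injective _ hε hmn))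

lemma finsum_bravaisLattice {B : Matrix (Fin 3) (Fin 3) ℝ} (hB : IsUnit B.det)
    {φ : (Fin 3 → ℝ) → ℝ} (hφ : ContDiff ℝ (⊤ : ℕ∞) φ) {ε R : ℝ} (hε : 0 < ε) (hR : 0 < R)
    (w : (Fin 3 → ℝ) → ℝ) (x v : Fin 3 → ℝ) :
    ∑ᶠ y ∈ (fun z : Fin 3 → ℝ => ε • z) '' bravaisLattice B,
        fderiv ℝ (fun z => ((ε * R) ^ 3)⁻¹ * φ ((ε * R)⁻¹ • z)) y v * w (x + y)
      = ((ε * R) ^ 4)⁻¹ * ∑ᶠ n : Fin 3 → ℤ,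
          dirDeriv v φ (B.mulVec (R⁻¹ • intVec n)) * w (x + ε • B.mulVec (intVec n)) := by
  rw [image_smul_bravaisLattice, finsum_mem_range (injective_smul_mulVec_intVec hB hε.ne'),
    ← smul_eq_mul ((ε * R) ^ 4)⁻¹, smul_finsum]
  refine finsum_congr fun n => ?_
  rw [fderiv_scaled_apply hφ, smul_smul, Matrix.mulVec_smul]
  have h1 : (ε * R)⁻¹ * ε = R⁻¹ := by field_simp
  rw [h1, smul_eq_mul, ← mul_assoc, ← mul_assoc, pow_succ (ε * R) 3, mul_inv]
  ring

lemma exists_support_bound_comp_mulVec {B : Matrix (Fin 3) (Fin 3) ℝ} (hB : IsUnit B.det)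
    (ρ : ℝ) (hρ : 0 ≤ ρ) : ∃ r, 0 ≤ r ∧ ∀ z : Fin 3 → ℝ, ‖B.mulVec z‖ ≤ ρ → ‖z‖ ≤ r := by
  set A := LinearMap.toContinuousLinearMap (Matrix.toLin' B⁻¹)
  refine ⟨‖A‖ * ρ, by positivity, fun z hz => ?_⟩
  have h1 : A (B.mulVec z) = z := by
    simp [A, Matrix.nonsing_inv_mul B hB]
  calc ‖z‖ = ‖A (B.mulVec z)‖ := by rw [h1]
    _ ≤ ‖A‖ * ‖B.mulVec z‖ := A.le_opNorm _
    _ ≤ ‖A‖ * ρ := by gcongr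

lemma contDiff_mulVec (B : Matrix (Fin 3) (Fin 3) ℝ) :
    ContDiff ℝ (⊤ : ℕ∞) fun z : Fin 3 → ℝ => B.mulVec z :=
  (LinearMap.toContinuousLinearMap (Matrix.toLin' B)).contDiff

lemma fderiv_apply_eq_sum (w : (Fin 3 → ℝ) → ℝ) (x v : Fin 3 → ℝ) :
    fderiv ℝ w x v = ∑ β, fderiv ℝ w x (Pi.single β 1) * v β := by
  conv_lhs => rw [pi_eq_sum_univ' v, map_sum]
  exact Finset.sum_congr rfl fun β _ => by rw [map_smul, smul_eq_mul, mul_comm]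

/-- Weighting `w` with an odd function on the lattice only sees the gradient of `w`, up to a
third order remainder. -/
lemma abs_finsum_odd_mul_sub_le {B : Matrix (Fin 3) (Fin 3) ℝ} {u : (Fin 3 → ℤ) → ℝ}
    {r ρ₀ ε R Mu M : ℝ} (hr : 0 ≤ r) (hρ₀ : 0 ≤ ρ₀) (hε : 0 < ε) (hR : 0 < R)
    (hMu : 0 ≤ Mu) (hodd : ∀ n, u (-n) = -u n) (hub : ∀ n, |u n| ≤ Mu)
    (hus : ∀ n, u n ≠ 0 → n ∈ intBox 0 r)
    (huB : ∀ n, u n ≠ 0 → ‖B.mulVec (intVec n)‖ ≤ ρ₀ * R)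
    {w : (Fin 3 → ℝ) → ℝ} (hw : ContDiff ℝ 3 w)
    (hM : ∀ (x : Fin 3 → ℝ) (idx : Fin 3 → Fin 3),
      |iteratedFDeriv ℝ 3 w x (fun k => Pi.single (idx k) 1)| ≤ M) (x : Fin 3 → ℝ) :
    |∑ᶠ n, u n * w (x + ε • B.mulVec (intVec n))
      - ε * ∑ β, fderiv ℝ w x (Pi.single β 1) * ∑ᶠ n, u n * B.mulVec (intVec n) β|
      ≤ Mu * (27 * M * (ε * (ρ₀ * R)) ^ 3) * (2 * r + 1) ^ 3 := by
  have hM0 : 0 ≤ M := (abs_nonneg _).trans (hM 0 0)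
  set S := intBox 0 r
  have hS : ∀ g : (Fin 3 → ℤ) → ℝ, ∑ᶠ n, u n * g n = ∑ n ∈ S, u n * g n := fun g =>
    finsum_eq_sum_of_support_subset _ fun n hn => hus n (left_ne_zero_of_mul hn)
  have hneg : ∑ᶠ n, u n * w (x + ε • B.mulVec (intVec n))
      = -∑ n ∈ S, u n * w (x - ε • B.mulVec (intVec n)) := by
    rw [← finsum_comp_equiv (Equiv.neg (Fin 3 → ℤ)), ← hS, ← finsum_neg_distrib]
    refine finsum_congr fun n => ?_
    simp [hodd, intVec_neg, Matrix.mulVec_neg, sub_eq_add_neg]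
  have hlin : ∑ β, fderiv ℝ w x (Pi.single β 1) * ∑ᶠ n, u n * B.mulVec (intVec n) β
      = ∑ n ∈ S, u n * fderiv ℝ w x (B.mulVec (intVec n)) := by
    simp only [hS, Finset.mul_sum]
    rw [Finset.sum_comm]
    refine Finset.sum_congr rfl fun n _ => ?_
    rw [fderiv_apply_eq_sum, Finset.mul_sum]
    exact Finset.sum_congr rfl fun β _ => by ring
  have hrem : ∑ᶠ n, u n * w (x + ε • B.mulVec (intVec n))
      - ε * ∑ β, fderiv ℝ w x (Pi.single β 1) * ∑ᶠ n, u n * B.mulVec (intVec n) β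
      = ∑ᶠ n, u n * ((w (x + ε • B.mulVec (intVec n)) - w (x - ε • B.mulVec (intVec n))
          - 2 * fderiv ℝ w x (ε • B.mulVec (intVec n))) / 2) := by
    have hpos := hS fun n => w (x + ε • B.mulVec (intVec n))
    have hexp : ∑ n ∈ S, u n * ((w (x + ε • B.mulVec (intVec n))
          - w (x - ε • B.mulVec (intVec n))
          - 2 * fderiv ℝ w x (ε • B.mulVec (intVec n))) / 2)
        = (∑ n ∈ S, u n * w (x + ε • B.mulVec (intVec n))) / 2
          - (∑ n ∈ S, u n * w (x - ε • B.mulVec (intVec n))) / 2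
          - ε * ∑ n ∈ S, u n * fderiv ℝ w x (B.mulVec (intVec n)) := by
      rw [Finset.sum_div, Finset.sum_div, Finset.mul_sum, ← Finset.sum_sub_distrib,
        ← Finset.sum_sub_distrib]
      refine Finset.sum_congr rfl fun n _ => ?_
      rw [map_smul, smul_eq_mul]
      ring
    refine Eq.trans ?_ (hS _).symm
    rw [hexp, hlin]
    linarith
  rw [hrem]
  refine abs_finsum_le hr (by positivity) 0 (fun n hn => hus n (left_ne_zero_of_mul hn))
    fun n => ?_
  by_cases hn : u n = 0
  · rw [hn, zero_mul, abs_zero]; positivity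
  · rw [abs_mul]
    refine mul_le_mul (hub n) ?_ (abs_nonneg _) hMu
    have h1 := abs_symm_difference_sub_le hw hM x (ε • B.mulVec (intVec n))
    have h2 : ‖ε • B.mulVec (intVec n)‖ ≤ ε * (ρ₀ * R) := by
      rw [norm_smul, Real.norm_of_nonneg hε.le]
      exact mul_le_mul_of_nonneg_left (huB n hn) hε.le
    have h3 : M * ‖ε • B.mulVec (intVec n)‖ ^ 3 ≤ M * (ε * (ρ₀ * R)) ^ 3 := by gcongr
    rw [abs_div, abs_two]
    linarith

/-- Error bound for one component of the sampled gradient. -/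
lemma exists_sampled_partial_error {B : Matrix (Fin 3) (Fin 3) ℝ} (hB : IsUnit B.det)
    {φ : (Fin 3 → ℝ) → ℝ} (hφ : ContDiff ℝ (⊤ : ℕ∞) φ) (hc : HasCompactSupport φ)
    (hsymm : ∀ x, φ (-x) = φ x) (hint : ∫ x, φ x = 1) (α : Fin 3) :
    ∃ C : ℝ, 0 ≤ C ∧ ∀ ε R : ℝ, 0 < ε → 1 ≤ R →
      ∀ (w : (Fin 3 → ℝ) → ℝ) (M₁ M₃ : ℝ), ContDiff ℝ 3 w →
      (∀ (x : Fin 3 → ℝ) (α : Fin 3), |fderiv ℝ w x (Pi.single α 1)| ≤ M₁) →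
      (∀ (x : Fin 3 → ℝ) (idx : Fin 3 → Fin 3),
        |iteratedFDeriv ℝ 3 w x (fun k => Pi.single (idx k) 1)| ≤ M₃) →
      ∀ x : Fin 3 → ℝ,
        |-(ε ^ 3 * |B.det|) *
              (∑ᶠ y ∈ (fun z : Fin 3 → ℝ => ε • z) '' bravaisLattice B,
                fderiv ℝ (fun z => ((ε * R) ^ 3)⁻¹ * φ ((ε * R)⁻¹ • z)) y
                    (Pi.single α 1) * w (x + y))
          - fderiv ℝ w x (Pi.single α 1)|
          ≤ C * (M₁ / R ^ 3 + M₃ * ε ^ 2 * R ^ 2) := by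
  obtain ⟨ρ₀, hρ₀, hφs⟩ : ∃ ρ₀, 0 ≤ ρ₀ ∧ ∀ z, φ z ≠ 0 → ‖z‖ ≤ ρ₀ := by
    obtain ⟨ρ, hρ⟩ := hc.isCompact.isBounded.exists_norm_le
    exact ⟨max ρ 0, le_max_right _ _, fun z hz =>
      (hρ z (subset_tsupport _ hz)).trans (le_max_left _ _)⟩
  set q := dirDeriv (Pi.single α 1) φ
  have hq : ContDiff ℝ (⊤ : ℕ∞) q := contDiff_dirDeriv _ hφ
  have hqs : ∀ z, q z ≠ 0 → ‖z‖ ≤ ρ₀ := dirDeriv_support hφs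
  obtain ⟨Mq, hMq0, hMq⟩ := exists_bound_of_support hq.continuous hqs
  obtain ⟨ρ, hρ, hBρ⟩ := exists_support_bound_comp_mulVec hB ρ₀ hρ₀
  have hps : ∀ z, q (B.mulVec z) ≠ 0 → ‖z‖ ≤ ρ := fun z hz => hBρ z (hqs _ hz)
  have hcB : ContDiff ℝ (⊤ : ℕ∞) fun z => q (B.mulVec z) := hq.comp (contDiff_mulVec B)
  set f : Fin 3 → (Fin 3 → ℝ) → ℝ := fun β z => q (B.mulVec z) * B.mulVec z β with hf
  have hI : ∀ β, |B.det| * ∫ z, f β z = -(Pi.single α 1 : Fin 3 → ℝ) β := fun β => by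
    rw [← integral_dirDeriv_mul_coord hφ hc hint α β]
    exact abs_det_mul_integral_comp_mulVec hB.ne_zero (F := fun z => q z * z β)
      (hq.continuous.mul (continuous_apply β))
  have hRS : ∀ β, ∃ K, ∀ h ∈ Set.Ioc (0 : ℝ) 1,
      |h ^ 3 * ∑ᶠ n : Fin 3 → ℤ, f β (h • intVec n) - ∫ x, f β x| ≤ K * h ^ 3 := fun β =>
    exists_abs_riemannSum_sub_integral_le hρ
      (hcB.mul (contDiff_pi.1 (contDiff_mulVec B) β))
      fun z hz => hps z (left_ne_zero_of_mul hz)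
  choose K hK using hRS
  have hK0 : ∀ β, 0 ≤ K β := fun β => by
    have := (abs_nonneg _).trans (hK β 1 (by simp)); simpa using this
  have hΩ : 0 < |B.det| := abs_pos.2 hB.ne_zero
  have hC1 : 0 ≤ |B.det| * ∑ β, K β := mul_nonneg hΩ.le (Finset.sum_nonneg fun β _ => hK0 β)
  have hC2 : 0 ≤ |B.det| * (27 * Mq * ρ₀ ^ 3 * (2 * ρ + 1) ^ 3) := by positivity
  refine ⟨|B.det| * ∑ β, K β + |B.det| * (27 * Mq * ρ₀ ^ 3 * (2 * ρ + 1) ^ 3),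
    by linarith, fun ε R hε hR w M₁ M₃ hw hM₁ hM₃ x => ?_⟩
  have hR0 : 0 < R := by linarith
  have hM₁0 : 0 ≤ M₁ := (abs_nonneg _).trans (hM₁ 0 0)
  have hM₃0 : 0 ≤ M₃ := (abs_nonneg _).trans (hM₃ 0 0)
  have hh : R⁻¹ ∈ Set.Ioc (0 : ℝ) 1 := ⟨inv_pos.2 hR0, inv_le_one_of_one_le₀ hR⟩
  have hscale : ∀ n β, B.mulVec (intVec n) β = R * B.mulVec (R⁻¹ • intVec n) β := by
    intro n β
    rw [Matrix.mulVec_smul, Pi.smul_apply, smul_eq_mul, mul_inv_cancel_left₀ hR0.ne']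
  rw [finsum_bravaisLattice hB hφ hε hR0]
  have hE := abs_finsum_odd_mul_sub_le (B := B) (u := fun n => q (B.mulVec (R⁻¹ • intVec n)))
    (r := ρ / R⁻¹) (ρ₀ := ρ₀) (R := R) (div_nonneg hρ hh.1.le) hρ₀ hε hR0 hMq0
    (fun n => by
      rw [intVec_neg, smul_neg, Matrix.mulVec_neg]; exact dirDeriv_neg hφ hsymm _ _)
    (fun n => hMq _)
    (fun n hn => mem_intBox_of_ne_zero (g := fun z => q (B.mulVec z)) hps hh.1 0 n
      (by simpa using hn))
    (fun n hn => by
      have := hqs _ hn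
      rw [Matrix.mulVec_smul, norm_smul, Real.norm_of_nonneg hh.1.le] at this
      rwa [inv_mul_le_iff₀ hR0, mul_comm] at this)
    hw hM₃ x
  set A := ∑ᶠ n : Fin 3 → ℤ, q (B.mulVec (R⁻¹ • intVec n)) * w (x + ε • B.mulVec (intVec n))
  set T : Fin 3 → ℝ := fun β => ∑ᶠ n : Fin 3 → ℤ, f β (R⁻¹ • intVec n) with hT
  have hTR : ∀ β, ∑ᶠ n : Fin 3 → ℤ,
      q (B.mulVec (R⁻¹ • intVec n)) * B.mulVec (intVec n) β = R * T β := by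
    intro β
    rw [hT, ← smul_eq_mul, smul_finsum]
    refine finsum_congr fun n => ?_
    rw [hscale, smul_eq_mul, hf]
    ring
  simp only [hTR] at hE
  set d : Fin 3 → ℝ := fun β => fderiv ℝ w x (Pi.single β 1) with hd
  set E := A - ε * ∑ β, d β * (R * T β) with hEdef
  have hmain : |∑ β, d β * ((R⁻¹) ^ 3 * T β - ∫ z, f β z)| ≤ (∑ β, K β) * (M₁ / R ^ 3) := by
    calc _ ≤ ∑ β, |d β * ((R⁻¹) ^ 3 * T β - ∫ z, f β z)| := Finset.abs_sum_le_sum_abs _ _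
      _ ≤ ∑ β, M₁ * (K β * (R⁻¹) ^ 3) := by
          refine Finset.sum_le_sum fun β _ => ?_
          rw [abs_mul]
          exact mul_le_mul (hM₁ x β) (hK β _ hh) (abs_nonneg _) hM₁0
      _ = _ := by
          rw [Finset.sum_mul]
          refine Finset.sum_congr rfl fun β _ => ?_
          rw [inv_pow, div_eq_mul_inv]
          ring
  have hdα : |B.det| * ∑ β, d β * ∫ z, f β z = -d α := by
    rw [Finset.mul_sum]
    calc _ = ∑ β, d β * (|B.det| * ∫ z, f β z) := Finset.sum_congr rfl fun β _ => by ring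
      _ = -d α := by simp [hI, Pi.single_apply]
  have hdecomp : -(ε ^ 3 * |B.det|) * (((ε * R) ^ 4)⁻¹ * A) - d α
      = -(|B.det| * ∑ β, d β * ((R⁻¹) ^ 3 * T β - ∫ z, f β z))
        - |B.det| * (ε * R ^ 4)⁻¹ * E := by
    have hsplit : ∑ β, d β * ((R⁻¹) ^ 3 * T β - ∫ z, f β z)
        = (R⁻¹) ^ 3 * ∑ β, d β * T β - ∑ β, d β * ∫ z, f β z := by
      rw [Finset.mul_sum, ← Finset.sum_sub_distrib]
      exact Finset.sum_congr rfl fun β _ => by ring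
    have hA : A = E + ε * (R * ∑ β, d β * T β) := by
      have : R * ∑ β, d β * T β = ∑ β, d β * (R * T β) := by
        rw [Finset.mul_sum]
        exact Finset.sum_congr rfl fun β _ => by ring
      rw [this, hEdef]
      ring
    rw [hsplit, hA, mul_sub, hdα]
    have := hε.ne'
    have := hR0.ne'
    field_simp
    ring
  have hEb : |E| ≤ Mq * (27 * M₃ * (ε * (ρ₀ * R)) ^ 3) * ((2 * ρ + 1) ^ 3 * R ^ 3) := by
    refine hE.trans ?_
    have h7 := two_mul_div_add_one_pow_le hρ hh
    rw [inv_pow, div_inv_eq_mul _ (R ^ 3)] at h7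
    gcongr
  have hE2 : |B.det| * (ε * R ^ 4)⁻¹ * |E|
      ≤ |B.det| * (27 * Mq * ρ₀ ^ 3 * (2 * ρ + 1) ^ 3) * (M₃ * ε ^ 2 * R ^ 2) := by
    calc _ ≤ |B.det| * (ε * R ^ 4)⁻¹ *
          (Mq * (27 * M₃ * (ε * (ρ₀ * R)) ^ 3) * ((2 * ρ + 1) ^ 3 * R ^ 3)) := by gcongr
      _ = _ := by field_simp
  have hE1 : |B.det| * |∑ β, d β * ((R⁻¹) ^ 3 * T β - ∫ z, f β z)|
      ≤ |B.det| * (∑ β, K β) * (M₁ / R ^ 3) := by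
    rw [mul_assoc]; gcongr
  change |-(ε ^ 3 * |B.det|) * (((ε * R) ^ 4)⁻¹ * A) - d α| ≤ _
  rw [hdecomp]
  refine (abs_sub _ _).trans ?_
  rw [abs_neg, abs_mul, abs_mul, abs_mul, abs_abs, abs_of_pos (a := (ε * R ^ 4)⁻¹) (by positivity)]
  have p1 : 0 ≤ M₁ / R ^ 3 := by positivity
  have p2 : 0 ≤ M₃ * ε ^ 2 * R ^ 2 := by positivity
  have := mul_nonneg hC1 p2
  have := mul_nonneg hC2 p1
  linarith

/-- Let `L` be a Bravais lattice with unit-cell volume `Ω₀ = |det B|`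
and `φ₀` a smooth compactly supported even kernel with `∫ φ₀ = 1`. For lattice spacing
`ε ∈ (0,1]` and sampling radius `εR` (`R ≥ 1`) consider the rescaled lattice `εL`, the
kernel `κ(x) = (εR)⁻³ φ₀(x/(εR))`, and suppose `Σ_{y∈εL} κ(y) = 1/(ε³Ω₀)`. Then there is
a constant `C` (depending only on `φ₀` and `B`) such that for every `C³` function `w`
with first partials bounded by `M₁` and third partials bounded by `M₃`, the sampled
gradient `G(x) = −ε³Ω₀ Σ_{y∈εL} ∇κ(y) w(x+y)` satisfies
`‖G(x) − ∇w(x)‖ ≤ C (M₁ R⁻³ + M₃ ε² R²)` for every `x`. -/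
theorem sampled_gradient_combined_error
    (B : Matrix (Fin 3) (Fin 3) ℝ) (hB : IsUnit B.det)
    (φ₀ : (Fin 3 → ℝ) → ℝ) (hφ : ContDiff ℝ (⊤ : ℕ∞) φ₀) (hc : HasCompactSupport φ₀)
    (hsymm : ∀ x : Fin 3 → ℝ, φ₀ (-x) = φ₀ x)
    (hint : (∫ x : Fin 3 → ℝ, φ₀ x) = 1) :
    ∃ C : ℝ, ∀ ε R : ℝ, ε ∈ Set.Ioc (0:ℝ) 1 → 1 ≤ R →
      (∑ᶠ y ∈ (fun z : Fin 3 → ℝ => ε • z) '' bravaisLattice B,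
          ((ε * R) ^ 3)⁻¹ * φ₀ ((ε * R)⁻¹ • y)) = 1 / (ε ^ 3 * |B.det|) →
      ∀ (w : (Fin 3 → ℝ) → ℝ) (M₁ M₃ : ℝ), ContDiff ℝ 3 w →
      (∀ (x : Fin 3 → ℝ) (α : Fin 3), |fderiv ℝ w x (Pi.single α 1)| ≤ M₁) →
      (∀ (x : Fin 3 → ℝ) (idx : Fin 3 → Fin 3),
        |iteratedFDeriv ℝ 3 w x (fun k => Pi.single (idx k) 1)| ≤ M₃) →
      ∀ x : Fin 3 → ℝ,
        ‖(fun α : Fin 3 => -(ε ^ 3 * |B.det|) *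
              (∑ᶠ y ∈ (fun z : Fin 3 → ℝ => ε • z) '' bravaisLattice B,
                fderiv ℝ (fun z => ((ε * R) ^ 3)⁻¹ * φ₀ ((ε * R)⁻¹ • z)) y
                    (Pi.single α 1) * w (x + y)))
          - (fun α : Fin 3 => fderiv ℝ w x (Pi.single α 1))‖
          ≤ C * (M₁ / R ^ 3 + M₃ * ε ^ 2 * R ^ 2) := by
  choose C hC0 hC using exists_sampled_partial_error hB hφ hc hsymm hint
  refine ⟨∑ α, C α, fun ε R hε hR _ w M₁ M₃ hw hM₁ hM₃ x => ?_⟩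
  have hM₁0 : 0 ≤ M₁ := (abs_nonneg _).trans (hM₁ 0 0)
  have hM₃0 : 0 ≤ M₃ := (abs_nonneg _).trans (hM₃ 0 0)
  have hR0 : 0 < R := by linarith
  have hε0 := hε.1
  have hpos : 0 ≤ M₁ / R ^ 3 + M₃ * ε ^ 2 * R ^ 2 := by positivity
  refine (pi_norm_le_iff_of_nonneg
    (mul_nonneg (Finset.sum_nonneg fun α _ => hC0 α) hpos)).2 fun α => ?_
  exact (hC α ε R hε.1 hR w M₁ M₃ hw hM₁ hM₃ x).trans
    (mul_le_mul_of_nonneg_right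
      (Finset.single_le_sum (fun β _ => hC0 β) (Finset.mem_univ α)) hpos)
end
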